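/- arXiv:2103.05249 — 5 statements merged into one kernel-verified Lean document; each statement's English description precedes it below -/
import Mathlib

section
/- Let 𝒜 ∈ ℝ^{n×n}, ℬ ∈ ℝ^{n×p}, 𝒞 ∈ ℝ^{p×n} with 𝒞ℬ = 0 and det(𝒞𝒜ℬ) ≠ 0. Then the 2p × n matrix obtained by stacking 𝒞 above 𝒞𝒜 has rank 2p; in particular n ≥ 2p. -/
open Matrix

/-- For a system of relative degree two (`𝒞ℬ = 0`, `det(𝒞𝒜ℬ) ≠ 0`), the matrix obtained
by stacking `𝒞` above `𝒞𝒜` has full row rank `2p`; in particular `n ≥ 2p`. -/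
theorem rank_stack_C_CA_relative_degree_two
    (n p : ℕ) (𝒜 : Matrix (Fin n) (Fin n) ℝ) (ℬ : Matrix (Fin n) (Fin p) ℝ)
    (𝒞 : Matrix (Fin p) (Fin n) ℝ)
    (hCB : 𝒞 * ℬ = 0) (hCAB : (𝒞 * 𝒜 * ℬ).det ≠ 0) :
    (Matrix.fromRows 𝒞 (𝒞 * 𝒜)).rank = 2 * p ∧ 2 * p ≤ n := by
  have hfactor : fromRows 𝒞 (𝒞 * 𝒜) * fromCols (𝒜 * ℬ) ℬ =
      fromBlocks (𝒞 * 𝒜 * ℬ) 0 (𝒞 * 𝒜 * (𝒜 * ℬ)) (𝒞 * 𝒜 * ℬ) := by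
    rw [fromRows_mul_fromCols, hCB, Matrix.mul_assoc 𝒞 𝒜 ℬ]
  have hunit : IsUnit (fromRows 𝒞 (𝒞 * 𝒜) * fromCols (𝒜 * ℬ) ℬ) := by
    rw [hfactor, isUnit_iff_isUnit_det, det_fromBlocks_zero₁₂]
    exact (mul_ne_zero hCAB hCAB).isUnit
  have hrank : (fromRows 𝒞 (𝒞 * 𝒜)).rank = 2 * p := by
    refine le_antisymm ?_ ?_
    · simpa [two_mul] using (fromRows 𝒞 (𝒞 * 𝒜)).rank_le_card_height
    · have h := rank_mul_le_left (fromRows 𝒞 (𝒞 * 𝒜)) (fromCols (𝒜 * ℬ) ℬ)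
      rw [rank_of_isUnit _ hunit] at h
      simpa [two_mul] using h
  exact ⟨hrank, by simpa [hrank] using (fromRows 𝒞 (𝒞 * 𝒜)).rank_le_card_width⟩
end

section
/- Let 𝒜 ∈ ℝ^{n×n}, ℬ ∈ ℝ^{n×p}, 𝒞 ∈ ℝ^{p×n} with 𝒞ℬ = 0 and det(𝒞𝒜ℬ) ≠ 0 (so n ≥ 2p). Then there exists a matrix 𝒞_z ∈ ℝ^{(n−2p)×n} such that 𝒞_zℬ = 0 and the square matrix T ∈ ℝ^{n×n} obtained by stacking 𝒞_z, 𝒞 and 𝒞𝒜 (T = [𝒞_z; 𝒞; 𝒞𝒜]) is invertible. -/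
open Matrix

/-- The map `x ↦ (𝒞x, 𝒞𝒜x)` is onto when `𝒞ℬ = 0` and `𝒞𝒜ℬ` is invertible. -/
theorem fromRows_mulVec_surjective_of_relative_degree_two {K m q : Type*} [Field K]
    [Fintype m] [Fintype q] [DecidableEq q]
    {A : Matrix m m K} {B : Matrix m q K} {C : Matrix q m K}
    (hCB : C * B = 0) (hCAB : IsUnit (C * A * B).det) :
    Function.Surjective (Matrix.fromRows C (C * A)).mulVecLin := by
  intro v
  set G := (C * A * B)⁻¹
  have hG : C * A * B * G = 1 := Matrix.mul_nonsing_inv _ hCAB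
  obtain ⟨x, hx⟩ : ∃ x, C *ᵥ x = v ∘ Sum.inl := ⟨(A * B * G) *ᵥ (v ∘ Sum.inl), by
    rw [Matrix.mulVec_mulVec, ← Matrix.mul_assoc, ← Matrix.mul_assoc, hG, Matrix.one_mulVec]⟩
  refine ⟨x + (B * G) *ᵥ (v ∘ Sum.inr - (C * A) *ᵥ x), ?_⟩
  rw [Matrix.mulVecLin_apply, Matrix.fromRows_mulVec, Matrix.mulVec_add, Matrix.mulVec_add,
    Matrix.mulVec_mulVec _ C, Matrix.mulVec_mulVec _ (C * A), ← Matrix.mul_assoc,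
    ← Matrix.mul_assoc, hCB, hG, hx, Matrix.zero_mul, Matrix.zero_mulVec, Matrix.one_mulVec,
    add_zero, add_sub_cancel, Sum.elim_comp_inl_inr]

/-- There are `n - 2p` linear functionals vanishing on the range of `ℬ` that separate the points
of the common kernel of `𝒞` and `𝒞𝒜`. -/
theorem exists_mul_eq_zero_and_mulVec_injOn_ker {K m q : Type*} [Field K]
    [Fintype m] [DecidableEq m] [Fintype q] [DecidableEq q] {r : ℕ}
    {A : Matrix m m K} {B : Matrix m q K} {C : Matrix q m K}
    (hCB : C * B = 0) (hCAB : IsUnit (C * A * B).det)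
    (hr : Fintype.card m = r + 2 * Fintype.card q) :
    ∃ Z : Matrix (Fin r) m K, Z * B = 0 ∧
      ∀ x, Z *ᵥ x = 0 → C *ᵥ x = 0 → (C * A) *ᵥ x = 0 → x = 0 := by
  set Φ := (Matrix.fromRows C (C * A)).mulVecLin
  have hrank := Φ.finrank_range_add_finrank_ker
  rw [LinearMap.range_eq_top.2 (fromRows_mulVec_surjective_of_relative_degree_two hCB hCAB),
    finrank_top, Module.finrank_fintype_fun_eq_card, Module.finrank_fintype_fun_eq_card,
    Fintype.card_sum] at hrank
  let e : LinearMap.ker Φ ≃ₗ[K] (Fin r → K) :=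
    LinearEquiv.ofFinrankEq _ _ (by rw [Module.finrank_fin_fun]; omega)
  obtain ⟨f, hf⟩ := e.toLinearMap.exists_extend
  set G := (C * A * B)⁻¹
  have hG : G * (C * A * B) = 1 := Matrix.nonsing_inv_mul _ hCAB
  refine ⟨LinearMap.toMatrix' f * (1 - B * G * (C * A)), ?_, fun x hZ hC hCA => ?_⟩
  · rw [Matrix.mul_assoc, Matrix.sub_mul, Matrix.mul_assoc (B * G), Matrix.mul_assoc B, hG,
      Matrix.one_mul, Matrix.mul_one, sub_self, Matrix.mul_zero]
  · have hx : x ∈ LinearMap.ker Φ := by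
      rw [LinearMap.mem_ker, Matrix.mulVecLin_apply, Matrix.fromRows_mulVec, hC, hCA]
      exact Sum.elim_zero_zero
    rw [← Matrix.mulVec_mulVec, Matrix.sub_mulVec, ← Matrix.mulVec_mulVec, hCA,
      Matrix.mulVec_zero, sub_zero, Matrix.one_mulVec, LinearMap.toMatrix'_mulVec] at hZ
    have he : e ⟨x, hx⟩ = 0 := (LinearMap.congr_fun hf ⟨x, hx⟩).symm.trans hZ
    exact congrArg Subtype.val (e.map_eq_zero_iff.1 he)

/-- For a system of relative degree two (`𝒞ℬ = 0`, `det(𝒞𝒜ℬ) ≠ 0`, so `n ≥ 2p`), there is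
a complementary output matrix `𝒞_z` with `𝒞_zℬ = 0` such that stacking `𝒞_z`, `𝒞` and
`𝒞𝒜` gives an invertible square matrix `T`. -/
theorem exists_state_transformation_relative_degree_two
    (n p : ℕ) (𝒜 : Matrix (Fin n) (Fin n) ℝ) (ℬ : Matrix (Fin n) (Fin p) ℝ)
    (𝒞 : Matrix (Fin p) (Fin n) ℝ)
    (hCB : 𝒞 * ℬ = 0) (hCAB : (𝒞 * 𝒜 * ℬ).det ≠ 0) (h2p : 2 * p ≤ n) :
    ∃ 𝒞z : Matrix (Fin (n - 2 * p)) (Fin n) ℝ,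
      𝒞z * ℬ = 0 ∧
      IsUnit ((Matrix.fromRows 𝒞z (Matrix.fromRows 𝒞 (𝒞 * 𝒜))).submatrix
        (((Equiv.refl (Fin (n - 2 * p))).sumCongr finSumFinEquiv).trans
          (finSumFinEquiv.trans (finCongr (show n - 2 * p + (p + p) = n by omega)))).symm id) := by
  obtain ⟨Z, hZB, hZ⟩ := exists_mul_eq_zero_and_mulVec_injOn_ker (r := n - 2 * p) hCB
    (isUnit_iff_ne_zero.2 hCAB) (by simp only [Fintype.card_fin]; omega)
  refine ⟨Z, hZB, Matrix.mulVec_injective_iff_isUnit.1 ?_⟩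
  rw [← Matrix.coe_mulVecLin, injective_iff_map_eq_zero]
  intro x hx
  rw [Matrix.mulVecLin_apply, ← Equiv.coe_refl, Matrix.submatrix_mulVec_equiv,
    Equiv.comp_symm_eq, Matrix.fromRows_mulVec, Matrix.fromRows_mulVec] at hx
  refine hZ x ?_ ?_ ?_
  · exact funext fun i => congrFun hx (Sum.inl i)
  · exact funext fun i => congrFun hx (Sum.inr (Sum.inl i))
  · exact funext fun i => congrFun hx (Sum.inr (Sum.inr i))
end

section
/- Let A11 ∈ ℝ^{m×m}, A12 ∈ ℝ^{m×p}, K1 ∈ ℝ^{p×m}, K2 ∈ ℝ^{p×p} be arbitrary, and define A = [[A11, A12],[K1, K2]] ∈ ℝ^{(m+p)×(m+p)} and B = [0; I_p] ∈ ℝ^{(m+p)×p}. Then the pair (A, B) is controllable if and only if the pair (A11, A12) is controllable. -/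
open Matrix

/-- PBH eigenvector test for controllability of a pair of real matrices `(M, N)`:
no eigenvector of `Mᵀ` (over `ℂ`) lies in the kernel of `Nᵀ`. -/
def IsControllablePair {k q : Type*} [Fintype k] [Fintype q]
    (M : Matrix k k ℝ) (N : Matrix k q ℝ) : Prop :=
  ∀ (μ : ℂ) (v : k → ℂ), v ≠ 0 →
    (M.map Complex.ofReal)ᵀ *ᵥ v = μ • v → (N.map Complex.ofReal)ᵀ *ᵥ v ≠ 0

/-- With `A = [[A11, A12], [K1, K2]]` and `B = [0; I]`, the pair `(A, B)` is controllable
if and only if `(A11, A12)` is controllable. -/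
theorem controllable_iff_relative_degree_one
    (m p : ℕ) (A11 : Matrix (Fin m) (Fin m) ℝ) (A12 : Matrix (Fin m) (Fin p) ℝ)
    (K1 : Matrix (Fin p) (Fin m) ℝ) (K2 : Matrix (Fin p) (Fin p) ℝ) :
    IsControllablePair (Matrix.fromBlocks A11 A12 K1 K2)
      (Matrix.fromRows (0 : Matrix (Fin m) (Fin p) ℝ) (1 : Matrix (Fin p) (Fin p) ℝ)) ↔
    IsControllablePair A11 A12 := by
  have hA (x : Fin m → ℂ) :
      ((fromBlocks A11 A12 K1 K2).map Complex.ofReal)ᵀ *ᵥ Sum.elim x 0 =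
        Sum.elim ((A11.map Complex.ofReal)ᵀ *ᵥ x) ((A12.map Complex.ofReal)ᵀ *ᵥ x) := by
    simp [fromBlocks_map, fromBlocks_transpose, fromBlocks_mulVec]
  have hB (x : Fin m → ℂ) (y : Fin p → ℂ) :
      ((fromRows (0 : Matrix (Fin m) (Fin p) ℝ) (1 : Matrix (Fin p) (Fin p) ℝ)).map
        Complex.ofReal)ᵀ *ᵥ Sum.elim x y = y := by
    ext i
    simp [mulVec, dotProduct, one_apply, apply_ite Complex.ofReal]
  constructor
  · intro h μ x hx hμ hN
    refine h μ (Sum.elim x 0) (fun h0 => hx ?_) ?_ (hB x 0)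
    · ext i
      exact congrFun h0 (Sum.inl i)
    · rw [hA, hμ, hN]
      ext (i | i) <;> simp
  · intro h μ v hv hμ hN
    obtain ⟨x, y, rfl⟩ : ∃ x y, v = Sum.elim x y := ⟨_, _, (Sum.elim_comp_inl_inr v).symm⟩
    obtain rfl : y = 0 := (hB x y).symm.trans hN
    rw [hA] at hμ
    refine h μ x (fun h0 => hv ?_) ?_ ?_
    · subst h0
      ext (i | i) <;> rfl
    · ext i
      exact congrFun hμ (Sum.inl i)
    · ext i
      simpa using congrFun hμ (Sum.inr i)
end

section
/- Let 𝒜 ∈ ℝ^{n×n}, ℬ ∈ ℝ^{n×p}, 𝒞 ∈ ℝ^{p×n} with det(𝒞ℬ) ≠ 0 (relative degree one). Let 𝒞_z ∈ ℝ^{(n−p)×n} satisfy 𝒞_zℬ = 0 with T = [𝒞_z; 𝒞] invertible, and let A11 ∈ ℝ^{(n−p)×(n−p)} be the top-left block of T𝒜T^{−1} (the zero dynamics matrix). Assume det(A11) ≠ 0 (the system has no zero at the origin). Then the following are equivalent: (i) there exist K_x ∈ ℝ^{p×n} and an invertible K_v ∈ ℝ^{p×p} such that the closed-loop realization (𝒜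 + ℬK_x, ℬK_v, 𝒞) is controllable and observable, det(𝒜 + ℬK_x) ≠ 0, and there exists a real symmetric positive definite Y ∈ ℝ^{n×n} with (𝒜 + ℬK_x)Y + Y(𝒜 + ℬK_x)ᵀ negative semidefinite and ℬK_v + (𝒜 + ℬK_x)Y𝒞ᵀ = 0; (ii) the pair (𝒜, ℬ) is controllable and A11 is Lyapunov stable (the system is weakly minimum phase). -/
open Matrix

/-- Eigenvector test for observability of a pair of real matrices `(M, L)`:
no eigenvector of `M` (over `ℂ`) lies in the kernel of `L`. -/
def IsObservablePair {k q : Type*} [Fintype k] [Fintype q]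
    (M : Matrix k k ℝ) (L : Matrix q k ℝ) : Prop :=
  ∀ (μ : ℂ) (v : k → ℂ), v ≠ 0 →
    (M.map Complex.ofReal) *ᵥ v = μ • v → (L.map Complex.ofReal) *ᵥ v ≠ 0

/-- A real square matrix is Lyapunov stable if every eigenvalue (over `ℂ`) has nonpositive
real part and every purely imaginary eigenvalue is semisimple
(`ker (M - μI)² = ker (M - μI)`). -/
def IsLyapunovStable {k : Type*} [Fintype k] [DecidableEq k] (M : Matrix k k ℝ) : Prop :=
  ∀ μ : ℂ, (∃ v : k → ℂ, v ≠ 0 ∧ (M.map Complex.ofReal) *ᵥ v = μ • v) →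
    μ.re ≤ 0 ∧ (μ.re = 0 →
      ∀ v : k → ℂ,
        (M.map Complex.ofReal - μ • 1) *ᵥ ((M.map Complex.ofReal - μ • 1) *ᵥ v) = 0 →
        (M.map Complex.ofReal - μ • 1) *ᵥ v = 0)

section complexification

open scoped ComplexOrder

variable {k l m : Type*}

theorem map_ofReal_mul [Fintype l] (M : Matrix k l ℝ) (N : Matrix l m ℝ) :
    (M * N).map Complex.ofReal = M.map Complex.ofReal * N.map Complex.ofReal :=
  Matrix.map_mul (f := Complex.ofRealHom)

theorem mulVec_map_ofReal_comp [Fintype l] [Fintype m] {M : Matrix k l ℝ}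
    {N : Matrix l m ℝ} {L : Matrix k m ℝ} (h : M * N = L) (v : m → ℂ) :
    M.map Complex.ofReal *ᵥ (N.map Complex.ofReal *ᵥ v) = L.map Complex.ofReal *ᵥ v := by
  rw [mulVec_mulVec, ← map_ofReal_mul, h]

theorem map_ofReal_add (M N : Matrix k l ℝ) :
    (M + N).map Complex.ofReal = M.map Complex.ofReal + N.map Complex.ofReal := by
  ext; simp

theorem map_ofReal_sub (M N : Matrix k l ℝ) :
    (M - N).map Complex.ofReal = M.map Complex.ofReal - N.map Complex.ofReal := by
  ext; simp

theorem map_ofReal_neg (M : Matrix k l ℝ) :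
    (-M).map Complex.ofReal = -M.map Complex.ofReal := by
  ext; simp

theorem map_ofReal_one [DecidableEq k] :
    (1 : Matrix k k ℝ).map Complex.ofReal = 1 :=
  Matrix.map_one _ Complex.ofReal_zero Complex.ofReal_one

theorem conjTranspose_map_ofReal (M : Matrix k l ℝ) :
    (M.map Complex.ofReal)ᴴ = Mᵀ.map Complex.ofReal := by
  ext; simp

variable [Fintype k] [Fintype l]

theorem posSemidef_map_ofReal {M : Matrix k k ℝ} (hM : M.PosSemidef) :
    (M.map Complex.ofReal).PosSemidef := by
  obtain ⟨n, v, rfl⟩ := posSemidef_iff_eq_sum_vecMulVec.mp hM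
  have : (∑ i, vecMulVec (v i) (star (v i))).map Complex.ofReal =
      ∑ i, vecMulVec (fun j => (v i j : ℂ)) (star fun j => (v i j : ℂ)) := by
    ext a b
    simp [Matrix.sum_apply, vecMulVec_apply]
  rw [this]
  exact posSemidef_sum _ fun i _ => posSemidef_vecMulVec_self_star _

theorem posDef_map_ofReal {M : Matrix k k ℝ} (hM : M.PosDef) :
    (M.map Complex.ofReal).PosDef := by
  classical
  refine (posSemidef_map_ofReal hM.posSemidef).posDef_iff_isUnit.mpr ?_
  exact hM.isUnit.map (Complex.ofRealHom.mapMatrix)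

theorem dotProduct_star_self_mulVec (M : Matrix k l ℝ) (w : k → ℂ) :
    star w ⬝ᵥ ((M * Mᵀ).map Complex.ofReal *ᵥ w) =
      star ((Mᵀ).map Complex.ofReal *ᵥ w) ⬝ᵥ ((Mᵀ).map Complex.ofReal *ᵥ w) := by
  rw [map_ofReal_mul, ← mulVec_mulVec, dotProduct_mulVec, star_mulVec, conjTranspose_map_ofReal,
    transpose_transpose]

/-- The Hermitian form of `M X + X Mᴴ` on a vector sent by `X` to an eigenvector of `M`. -/
theorem dotProduct_lyapunov_mulVec {M X : Matrix k k ℂ} (hX : X.IsHermitian) {μ : ℂ} {w : k → ℂ}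
    (h : M *ᵥ (X *ᵥ w) = μ • (X *ᵥ w)) :
    star w ⬝ᵥ ((M * X + X * Mᴴ) *ᵥ w) = ((2 * μ.re : ℝ) : ℂ) * (star w ⬝ᵥ (X *ᵥ w)) := by
  have h2 : star w ⬝ᵥ (X *ᵥ (Mᴴ *ᵥ w)) = star μ * (star w ⬝ᵥ (X *ᵥ w)) := by
    have : star (M *ᵥ (X *ᵥ w)) ⬝ᵥ w = star (μ • (X *ᵥ w)) ⬝ᵥ w := by rw [h]
    rw [star_mulVec, star_smul, smul_dotProduct, star_mulVec, hX.eq, ← dotProduct_mulVec,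
      ← dotProduct_mulVec, ← dotProduct_mulVec] at this
    rw [this, smul_eq_mul]
  rw [add_mulVec, dotProduct_add, ← mulVec_mulVec, ← mulVec_mulVec, h, h2, dotProduct_smul,
    smul_eq_mul, ← add_mul]
  congr 1
  rw [Complex.star_def, Complex.add_conj]

theorem map_ofReal_lyapunov (M S : Matrix k k ℝ) :
    (M * S + S * Mᵀ).map Complex.ofReal =
      M.map Complex.ofReal * S.map Complex.ofReal +
        S.map Complex.ofReal * (M.map Complex.ofReal)ᴴ := by
  rw [map_ofReal_add, map_ofReal_mul, map_ofReal_mul, conjTranspose_map_ofReal]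

theorem re_nonpos_of_lyapunov {M S : Matrix k k ℝ} (hS : S.PosDef)
    (hQ : (-(M * S + S * Mᵀ)).PosSemidef) {μ : ℂ} {w : k → ℂ} (hw : w ≠ 0)
    (h : M.map Complex.ofReal *ᵥ (S.map Complex.ofReal *ᵥ w) =
      μ • (S.map Complex.ofReal *ᵥ w)) : μ.re ≤ 0 := by
  have hSc := posDef_map_ofReal hS
  have h1 := (posSemidef_map_ofReal hQ).re_dotProduct_nonneg w
  have h2 := hSc.re_dotProduct_pos hw
  rw [map_ofReal_neg, neg_mulVec, dotProduct_neg, map_ofReal_lyapunov,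
    dotProduct_lyapunov_mulVec hSc.1 h] at h1
  simp only [map_neg, RCLike.re_to_complex, Complex.re_ofReal_mul] at h1 h2
  nlinarith

theorem lyapunov_mulVec_eq_zero {M S : Matrix k k ℝ} (hS : S.PosDef)
    (hQ : (-(M * S + S * Mᵀ)).PosSemidef) {μ : ℂ} {w : k → ℂ} (hμ : μ.re = 0)
    (h : M.map Complex.ofReal *ᵥ (S.map Complex.ofReal *ᵥ w) =
      μ • (S.map Complex.ofReal *ᵥ w)) :
    (M * S + S * Mᵀ).map Complex.ofReal *ᵥ w = 0 := by
  have hSc := posDef_map_ofReal hS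
  have := (posSemidef_map_ofReal hQ).dotProduct_mulVec_zero_iff w
  rw [map_ofReal_neg, neg_mulVec, dotProduct_neg, neg_eq_zero, neg_eq_zero] at this
  rw [← this, map_ofReal_lyapunov, dotProduct_lyapunov_mulVec hSc.1 h, hμ]
  simp

/-- Kernel vectors of the Lyapunov form yield left eigenvectors. -/
theorem transpose_mulVec_eq_of_lyapunov_mulVec_eq_zero {M S : Matrix k k ℝ} (hS : S.PosDef)
    {μ : ℂ} {w : k → ℂ}
    (h : M.map Complex.ofReal *ᵥ (S.map Complex.ofReal *ᵥ w) =
      μ • (S.map Complex.ofReal *ᵥ w))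
    (h0 : (M * S + S * Mᵀ).map Complex.ofReal *ᵥ w = 0) :
    (M.map Complex.ofReal)ᵀ *ᵥ w = (-μ) • w := by
  classical
  have hSc := posDef_map_ofReal hS
  rw [map_ofReal_add, map_ofReal_mul, map_ofReal_mul, add_mulVec, ← mulVec_mulVec, h,
    ← mulVec_mulVec] at h0
  have hinj := mulVec_injective_of_isUnit hSc.isUnit
  apply hinj
  rw [mulVec_smul, neg_smul, ← transpose_map]
  exact eq_neg_of_add_eq_zero_right h0

theorem isLyapunovStable_of_lyapunov [DecidableEq k] {M S : Matrix k k ℝ} (hS : S.PosDef)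
    (hQ : (-(M * S + S * Mᵀ)).PosSemidef) : IsLyapunovStable M := by
  have hSc := posDef_map_ofReal hS
  have hdet := (isUnit_iff_isUnit_det _).mp hSc.isUnit
  have key (v : k → ℂ) : ∃ w, S.map Complex.ofReal *ᵥ w = v :=
    ⟨(S.map Complex.ofReal)⁻¹ *ᵥ v, by rw [mulVec_mulVec, mul_nonsing_inv _ hdet, one_mulVec]⟩
  rintro μ ⟨v, hv, hMv⟩
  refine ⟨?_, fun hμ v hv2 => ?_⟩
  · obtain ⟨w, rfl⟩ := key v
    refine re_nonpos_of_lyapunov hS hQ (w := w) ?_ hMv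
    rintro rfl
    simp at hv
  · obtain ⟨w, hw⟩ := key ((M.map Complex.ofReal - μ • 1) *ᵥ v)
    have hMu : M.map Complex.ofReal *ᵥ (S.map Complex.ofReal *ᵥ w) =
        μ • (S.map Complex.ofReal *ᵥ w) := by
      rw [hw]
      rw [sub_mulVec, smul_mulVec, one_mulVec] at hv2
      exact sub_eq_zero.mp hv2
    have hT := transpose_mulVec_eq_of_lyapunov_mulVec_eq_zero hS hMu
      (lyapunov_mulVec_eq_zero hS hQ hμ hMu)
    have h0 : star w ⬝ᵥ (S.map Complex.ofReal *ᵥ w) = 0 := by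
      have hs : star ((M.map Complex.ofReal)ᵀ *ᵥ w) = star ((-μ) • w) := by rw [hT]
      rw [star_mulVec, star_smul, ← transpose_map, conjTranspose_map_ofReal,
        transpose_transpose] at hs
      have hc : star (-μ) = μ := by
        apply Complex.ext <;> simp [hμ]
      rw [hw, dotProduct_mulVec, vecMul_sub, hs, hc]
      simp [vecMul_smul]
    by_contra hne
    have hw0 : w ≠ 0 := by
      rintro rfl
      exact hne (by rw [← hw, mulVec_zero])
    exact (hSc.dotProduct_mulVec_pos hw0).ne' h0

end complexification

section polynomial

open Polynomial

variable {k : Type*} [Fintype k] [DecidableEq k]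

theorem aeval_map_ofReal_mulVec {M : Matrix k k ℝ} {μ : ℂ} {v : k → ℂ}
    (h : M.map Complex.ofReal *ᵥ v = μ • v) (f : ℝ[X]) :
    (aeval M f).map Complex.ofReal *ᵥ v = aeval μ f • v := by
  have hpow (i : ℕ) : (M ^ i).map Complex.ofReal *ᵥ v = μ ^ i • v := by
    induction i with
    | zero => rw [pow_zero, map_ofReal_one, one_mulVec, pow_zero, one_smul]
    | succ i ih =>
      rw [pow_succ, map_ofReal_mul, ← mulVec_mulVec, h, mulVec_smul, ih, smul_smul, pow_succ,
        mul_comm]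
  induction f using Polynomial.induction_on' with
  | add f g hf hg => rw [map_add, map_ofReal_add, add_mulVec, hf, hg, map_add, add_smul]
  | monomial i a =>
    rw [aeval_monomial, aeval_monomial, map_ofReal_mul, ← mulVec_mulVec, hpow, mulVec_smul,
      mul_comm, mul_smul]
    congr 1
    ext j
    simp [Matrix.algebraMap_eq_diagonal, mulVec, dotProduct, diagonal_apply, apply_ite]

theorem exists_factorization_re_eq_zero (q : ℝ[X]) (hq : q ≠ 0) :
    ∃ f g : ℝ[X], q = f * g ∧ (∀ z : ℂ, aeval z f = 0 → z.re = 0) ∧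
      ∀ z : ℂ, aeval z g = 0 → z.re ≠ 0 := by
  induction q using UniqueFactorizationMonoid.induction_on_prime with
  | h₁ => exact absurd rfl hq
  | h₂ u hu =>
    refine ⟨u, 1, by simp, fun z hz => ?_, by simp⟩
    exact absurd hz (hu.map (aeval z)).ne_zero
  | h₃ a p ha hp ih =>
    obtain ⟨f, g, rfl, hf, hg⟩ := ih ha
    by_cases hroot : ∃ z : ℂ, aeval z p = 0 ∧ z.re = 0
    · obtain ⟨z, hz, hz0⟩ := hroot
      refine ⟨p * f, g, by ring, fun y hy => ?_, hg⟩
      rw [map_mul, mul_eq_zero] at hy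
      rcases hy with hy | hy
      · have hzh : aeval z (X ^ 2 + C (z.im ^ 2)) = 0 := by
          apply Complex.ext <;> simp [pow_two, hz0]
        have hdvd : p ∣ X ^ 2 + C (z.im ^ 2) := by
          by_contra hnd
          obtain ⟨a, b, hab⟩ := hp.coprime_iff_not_dvd.mpr hnd
          have := congrArg (aeval z) hab
          rw [map_add, map_mul, map_mul, hz, hzh] at this
          simp at this
        have hyh : aeval y (X ^ 2 + C (z.im ^ 2)) = 0 := by
          obtain ⟨c, hc⟩ := hdvd
          rw [hc, map_mul, hy, zero_mul]
        have h1 := congrArg Complex.re hyh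
        have h2 := congrArg Complex.im hyh
        simp [pow_two] at h1 h2
        by_contra hne
        have h3 : y.im = 0 := by
          have : y.re * y.im = 0 := by linarith
          exact (mul_eq_zero.mp this).resolve_left hne
        rw [h3] at h1
        have := mul_self_pos.mpr hne
        nlinarith [mul_self_nonneg z.im]
      · exact hf y hy
    · push Not at hroot
      refine ⟨f, p * g, by ring, hf, fun y hy => ?_⟩
      rw [map_mul, mul_eq_zero] at hy
      exact hy.elim (hroot y) (hg y)

theorem isCoprime_of_re_eq_zero {f g : ℝ[X]} (hf : ∀ z : ℂ, aeval z f = 0 → z.re = 0)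
    (hg : ∀ z : ℂ, aeval z g = 0 → z.re ≠ 0) : IsCoprime f g := by
  rw [Polynomial.isCoprime_iff_aeval_ne_zero_of_isAlgClosed ℝ ℂ]
  intro z
  by_contra! h
  exact hg z h.2 (hf z h.1)

/-- The spectral projection `P` of a real matrix `M` along its purely imaginary eigenvalues. -/
theorem exists_spectral_projection (M : Matrix k k ℝ) :
    ∃ P : Matrix k k ℝ, P * P = P ∧ P * M = M * P ∧
      (∀ (μ : ℂ) (v : k → ℂ), M.map Complex.ofReal *ᵥ v = μ • v → μ.re = 0 →
        P.map Complex.ofReal *ᵥ v = 0) ∧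
      (∀ (μ : ℂ) (v : k → ℂ), M.map Complex.ofReal *ᵥ v = μ • v → μ.re ≠ 0 →
        P.map Complex.ofReal *ᵥ v = v) := by
  obtain ⟨f, g, hfg, hf, hg⟩ := exists_factorization_re_eq_zero M.charpoly M.charpoly_monic.ne_zero
  obtain ⟨a, b, hab⟩ := isCoprime_of_re_eq_zero hf hg
  have h0 : aeval M (f * g) = 0 := by rw [← hfg, Matrix.aeval_self_charpoly]
  have hvan (μ : ℂ) (v : k → ℂ) (hv : M.map Complex.ofReal *ᵥ v = μ • v) (hv0 : v ≠ 0) :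
      aeval μ f = 0 ∨ aeval μ g = 0 := by
    have := aeval_map_ofReal_mulVec hv (f * g)
    rw [h0, map_mul, Matrix.map_zero _ Complex.ofReal_zero, zero_mulVec] at this
    exact mul_eq_zero.mp ((smul_eq_zero.mp this.symm).resolve_right hv0)
  refine ⟨aeval M (a * f), ?_, ?_, fun μ v hv hμ => ?_, fun μ v hv hμ => ?_⟩
  · have : a * f * (a * f) = a * f - a * b * (f * g) := by linear_combination a * f * hab
    rw [← map_mul, this, map_sub, map_mul (aeval M) (a * b), h0, mul_zero, sub_zero]
  · have : aeval M (a * f) * aeval M (X : ℝ[X]) = aeval M (X : ℝ[X]) * aeval M (a * f) := by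
      rw [← map_mul, ← map_mul, mul_comm]
    simpa using this
  · rw [aeval_map_ofReal_mulVec hv]
    by_cases hv0 : v = 0
    · simp [hv0]
    · have := (hvan μ v hv hv0).resolve_right (fun h => hg μ h hμ)
      rw [map_mul, this, mul_zero, zero_smul]
  · rw [aeval_map_ofReal_mulVec hv]
    by_cases hv0 : v = 0
    · simp [hv0]
    · have h1 := (hvan μ v hv hv0).resolve_left (fun h => hμ (hf μ h))
      have h2 := congrArg (aeval μ) hab
      rw [map_add, map_mul, map_mul, h1, mul_zero, add_zero, map_one] at h2
      rw [map_mul, h2, one_smul]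

end polynomial

section stein

open scoped Matrix.Norms.Frobenius

variable {k : Type*} [Fintype k] [DecidableEq k]

theorem mem_spectrum_iff_exists_mulVec {M : Matrix k k ℂ} {μ : ℂ} :
    μ ∈ spectrum ℂ M ↔ ∃ v : k → ℂ, v ≠ 0 ∧ M *ᵥ v = μ • v := by
  rw [← spectrum_toLin', ← Module.End.hasEigenvalue_iff_mem_spectrum]
  constructor
  · intro h
    obtain ⟨v, hv⟩ := h.exists_hasEigenvector
    exact ⟨v, hv.2, by simpa using hv.apply_eq_smul⟩
  · rintro ⟨v, hv, h⟩
    exact Module.End.hasEigenvalue_of_hasEigenvector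
      (Module.End.hasEigenvector_iff.mpr ⟨Module.End.mem_eigenspace_iff.mpr (by simpa using h), hv⟩)

theorem exists_norm_pow_le_of_spectrum {M : Matrix k k ℂ} (h : ∀ z ∈ spectrum ℂ M, ‖z‖ < 1) :
    ∃ r : ℝ, 0 ≤ r ∧ r < 1 ∧ ∀ᶠ n : ℕ in Filter.atTop, ‖M ^ n‖ ≤ r ^ n := by
  rcases isEmpty_or_nonempty k with hk | hk
  · refine ⟨0, le_rfl, one_pos, Filter.Eventually.of_forall fun n => ?_⟩
    rw [Subsingleton.elim (M ^ n) 0, norm_zero]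
    exact pow_nonneg le_rfl n
  · have hlt : spectralRadius ℂ M < (1 : NNReal) :=
      spectrum.spectralRadius_lt_of_forall_lt M fun z hz => by exact_mod_cast h z hz
    obtain ⟨r, hr1, hr2⟩ := ENNReal.lt_iff_exists_nnreal_btwn.mp hlt
    refine ⟨r, r.2, by exact_mod_cast hr2, ?_⟩
    have ht := spectrum.pow_nnnorm_pow_one_div_tendsto_nhds_spectralRadius M
    filter_upwards [ht.eventually_lt_const hr1, Filter.eventually_gt_atTop 0] with n hn hn0
    have h1 : ((‖M ^ n‖₊ : ENNReal) ^ (1 / n : ℝ)) ^ (n : ℝ) ≤ (r : ENNReal) ^ (n : ℝ) :=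
      ENNReal.rpow_le_rpow hn.le (Nat.cast_nonneg n)
    rw [← ENNReal.rpow_mul, one_div_mul_cancel (by exact_mod_cast hn0.ne'), ENNReal.rpow_one,
      ENNReal.rpow_natCast] at h1
    exact_mod_cast h1

theorem exists_stein_solution {B Q : Matrix k k ℝ} (hQ : Q.PosSemidef)
    (hB : ∀ z ∈ spectrum ℂ (B.map Complex.ofReal), ‖z‖ < 1) :
    ∃ S : Matrix k k ℝ, S.PosSemidef ∧ S = Q + B * S * Bᵀ := by
  obtain ⟨r, hr0, hr1, hr⟩ := exists_norm_pow_le_of_spectrum hB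
  have hnorm (n : ℕ) : ‖(B.map Complex.ofReal) ^ n‖ = ‖B ^ n‖ := by
    rw [← frobenius_norm_map_eq (B ^ n) Complex.ofReal (fun a => by simp)]
    congr 1
    exact (map_pow Complex.ofRealHom.mapMatrix B n).symm
  have hsum : Summable fun n : ℕ => B ^ n * Q * (B ^ n)ᵀ := by
    have hgeom : Summable fun n : ℕ => ‖Q‖ * (r * r) ^ n :=
      (summable_geometric_of_lt_one (mul_nonneg hr0 hr0) (by nlinarith)).mul_left _
    refine hgeom.of_norm_bounded_eventually_nat ?_
    filter_upwards [hr] with n hn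
    rw [hnorm] at hn
    calc ‖B ^ n * Q * (B ^ n)ᵀ‖ ≤ ‖B ^ n‖ * ‖Q‖ * ‖(B ^ n)ᵀ‖ :=
          (norm_mul_le _ _).trans (mul_le_mul_of_nonneg_right (norm_mul_le _ _) (norm_nonneg _))
      _ = ‖Q‖ * (‖B ^ n‖ * ‖B ^ n‖) := by rw [frobenius_norm_transpose]; ring
      _ ≤ ‖Q‖ * (r ^ n * r ^ n) := by gcongr
      _ = ‖Q‖ * (r * r) ^ n := by rw [mul_pow]
  have hpsd (n : ℕ) : (B ^ n * Q * (B ^ n)ᵀ).PosSemidef := by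
    simpa using hQ.mul_mul_conjTranspose_same (B ^ n)
  refine ⟨∑' n : ℕ, B ^ n * Q * (B ^ n)ᵀ, .of_dotProduct_mulVec_nonneg ?_ fun x => ?_, ?_⟩
  · rw [IsHermitian, conjTranspose_tsum]
    exact tsum_congr fun n => (hpsd n).1
  · let φ : Matrix k k ℝ →+ ℝ :=
      { toFun := fun M => star x ⬝ᵥ (M *ᵥ x)
        map_zero' := by simp
        map_add' := fun M N => by rw [add_mulVec, dotProduct_add] }
    have hφ : Continuous φ :=
      continuous_const.dotProduct (continuous_id.matrix_mulVec continuous_const)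
    exact (hsum.hasSum.map φ hφ).nonneg fun n => (hpsd n).dotProduct_mulVec_nonneg x
  · conv_lhs => rw [hsum.tsum_eq_zero_add]
    rw [← hsum.tsum_mul_left, ← (hsum.mul_left B).tsum_mul_right]
    congr 1
    · simp
    · refine tsum_congr fun n => ?_
      rw [pow_succ', transpose_mul]
      simp only [Matrix.mul_assoc]

/-- Solution of the Lyapunov equation of a Hurwitz matrix, through its Cayley transform. -/
theorem exists_lyapunov_solution {M Q : Matrix k k ℝ} (hQ : Q.PosSemidef)
    (hM : ∀ (μ : ℂ) (v : k → ℂ), v ≠ 0 → M.map Complex.ofReal *ᵥ v = μ • v → μ.re < 0) :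
    ∃ S : Matrix k k ℝ, S.PosSemidef ∧ M * S + S * Mᵀ = -Q := by
  have hdet : IsUnit (M - 1).det := by
    rw [isUnit_iff_ne_zero]
    intro h0
    obtain ⟨v, hv, hMv⟩ := exists_mulVec_eq_zero_iff.mpr h0
    have h1 : M.map Complex.ofReal *ᵥ (fun i => (v i : ℂ)) = (1 : ℂ) • fun i => (v i : ℂ) := by
      rw [sub_mulVec, one_mulVec, sub_eq_zero] at hMv
      ext i
      have := congrArg Complex.ofReal (congrFun hMv i)
      simpa [mulVec, dotProduct] using this
    have := hM 1 _ (fun h => hv (funext fun i => by simpa using congrFun h i)) h1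
    norm_num at this
  set D := (M - 1)⁻¹
  have hDr : (M - 1) * D = 1 := mul_nonsing_inv _ hdet
  have hQ' : (D * ((2 : ℝ) • Q) * Dᵀ).PosSemidef := by
    simpa using (hQ.smul (zero_le_two (α := ℝ))).mul_mul_conjTranspose_same D
  obtain ⟨S, hS, hSeq⟩ := exists_stein_solution (B := D * (M + 1)) hQ' (by
    intro z hz
    obtain ⟨v, hv, hBv⟩ := mem_spectrum_iff_exists_mulVec.mp hz
    have h1 : M.map Complex.ofReal *ᵥ v + v = z • (M.map Complex.ofReal *ᵥ v - v) := by
      have := congrArg ((M - 1).map Complex.ofReal *ᵥ ·) hBv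
      rw [mulVec_mulVec, ← map_ofReal_mul, ← Matrix.mul_assoc, hDr, Matrix.one_mul,
        map_ofReal_add, map_ofReal_one, mulVec_smul, map_ofReal_sub, map_ofReal_one, add_mulVec,
        sub_mulVec, one_mulVec] at this
      exact this
    have hz1 : z - 1 ≠ 0 := by
      intro h0
      rw [sub_eq_zero.mp h0, one_smul] at h1
      apply hv
      ext i
      have := congrFun h1 i
      simp only [Pi.add_apply, Pi.sub_apply, Pi.zero_apply] at this ⊢
      linear_combination this / 2
    have h2 : M.map Complex.ofReal *ᵥ v = ((z + 1) / (z - 1)) • v := by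
      ext i
      have := congrFun h1 i
      simp only [Pi.add_apply, Pi.sub_apply, Pi.smul_apply, smul_eq_mul] at this ⊢
      field_simp
      linear_combination -this
    have h3 := hM _ v hv h2
    have h4 : ((z + 1) / (z - 1)).re = (‖z‖ ^ 2 - 1) / Complex.normSq (z - 1) := by
      rw [Complex.div_re, ← add_div, Complex.sq_norm, Complex.normSq_apply z]
      congr 1
      simp
      ring
    rw [h4, div_neg_iff] at h3
    have h5 := Complex.normSq_pos.mpr hz1
    have h6 : ‖z‖ ^ 2 < 1 := by rcases h3 with h | h <;> linarith
    exact (sq_lt_one_iff₀ (norm_nonneg z)).mp h6)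
  refine ⟨S, hS, ?_⟩
  have h1 : (M - 1) * S * (M - 1)ᵀ = (2 : ℝ) • Q + (M + 1) * S * (M + 1)ᵀ := by
    conv_lhs => rw [hSeq]
    have e1 : (M - 1) * (D * ((2 : ℝ) • Q) * Dᵀ + D * (M + 1) * S * (D * (M + 1))ᵀ) * (M - 1)ᵀ =
        ((M - 1) * D) * ((2 : ℝ) • Q) * ((M - 1) * D)ᵀ +
          ((M - 1) * D) * ((M + 1) * S * (M + 1)ᵀ) * ((M - 1) * D)ᵀ := by
      simp only [transpose_mul]
      noncomm_ring
    rw [e1, hDr]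
    simp
  have h2 : (2 : ℝ) • (M * S + S * Mᵀ) = (2 : ℝ) • (-Q) := by
    simp only [transpose_sub, transpose_add, transpose_one] at h1
    have e2 : (2 : ℝ) • (M * S + S * Mᵀ) =
        (M + 1) * S * (Mᵀ + 1) - (M - 1) * S * (Mᵀ - 1) := by
      rw [two_smul]
      noncomm_ring
    rw [e2, h1]
    simp
  exact smul_right_injective _ (two_ne_zero (α := ℝ)) h2

end stein

section center

variable {k : Type*} [Fintype k] [DecidableEq k]

theorem span_eigenvectors_eq_top {M : Matrix k k ℂ}
    (h : ∀ (μ : ℂ) (v : k → ℂ), (M - μ • 1) *ᵥ ((M - μ • 1) *ᵥ v) = 0 → (M - μ • 1) *ᵥ v = 0) :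
    ⊤ ≤ Submodule.span ℂ {v : k → ℂ | ∃ μ : ℂ, M *ᵥ v = μ • v} := by
  rw [← Module.End.iSup_maxGenEigenspace_eq_top (toLin' M)]
  refine iSup_le fun μ v hv => Submodule.subset_span ⟨μ, ?_⟩
  obtain ⟨n, hn⟩ := (Module.End.mem_maxGenEigenspace _ _ _).mp hv
  have key (w : k → ℂ) : (toLin' M - μ • 1) w = (M - μ • 1) *ᵥ w := by
    simp [sub_mulVec, smul_mulVec]
  have hpow : ∀ n : ℕ, ((toLin' M - μ • 1) ^ (n + 1)) v = 0 → (M - μ • 1) *ᵥ v = 0 := by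
    intro n
    induction n with
    | zero => intro h0; rwa [zero_add, pow_one, key] at h0
    | succ n ih =>
      intro h0
      rw [pow_succ', pow_succ', Module.End.mul_apply, Module.End.mul_apply, key, key] at h0
      apply ih
      rw [pow_succ', Module.End.mul_apply, key]
      exact h _ _ h0
  have := hpow n (by rw [pow_succ', Module.End.mul_apply, hn, map_zero])
  rwa [sub_mulVec, smul_mulVec, one_mulVec, sub_eq_zero] at this

/-- A matrix with purely imaginary semisimple spectrum preserves a positive definite form. -/
theorem exists_posDef_lyapunov_eq_zero {M : Matrix k k ℝ}
    (hre : ∀ (μ : ℂ) (v : k → ℂ), v ≠ 0 → M.map Complex.ofReal *ᵥ v = μ • v → μ.re = 0)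
    (hss : ∀ (μ : ℂ) (v : k → ℂ),
      (M.map Complex.ofReal - μ • 1) *ᵥ ((M.map Complex.ofReal - μ • 1) *ᵥ v) = 0 →
      (M.map Complex.ofReal - μ • 1) *ᵥ v = 0) :
    ∃ S : Matrix k k ℝ, S.PosDef ∧ M * S + S * Mᵀ = 0 := by
  let b := Module.Basis.ofSpan (span_eigenvectors_eq_top hss)
  have : Fintype ((linearIndepOn_empty ℂ id).extend
      (Set.empty_subset {v : k → ℂ | ∃ μ : ℂ, M.map Complex.ofReal *ᵥ v = μ • v})) :=
    FiniteDimensional.fintypeBasisIndex b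
  have hb (i) : ∃ μ : ℂ, M.map Complex.ofReal *ᵥ b i = μ • b i :=
    Module.Basis.ofSpan_subset (span_eigenvectors_eq_top hss) ⟨i, rfl⟩
  choose μ hμ using hb
  let x := fun i j => (b i j).re
  let y := fun i j => (b i j).im
  have hx (i) : M *ᵥ x i = (-(μ i).im) • y i := by
    have h0 := hre _ _ (b.ne_zero i) (hμ i)
    ext j
    have := congrArg Complex.re (congrFun (hμ i) j)
    simpa [mulVec, dotProduct, x, y, h0] using this
  have hy (i) : M *ᵥ y i = (μ i).im • x i := by
    have h0 := hre _ _ (b.ne_zero i) (hμ i)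
    ext j
    have := congrArg Complex.im (congrFun (hμ i) j)
    simpa [mulVec, dotProduct, x, y, h0] using this
  have hpsd (v : k → ℝ) : (vecMulVec v v).PosSemidef := by
    simpa using posSemidef_vecMulVec_self_star v
  refine ⟨∑ i, (vecMulVec (x i) (x i) + vecMulVec (y i) (y i)), ?_, ?_⟩
  · have hS := posSemidef_sum Finset.univ
      fun i _ => (hpsd (x i)).add (hpsd (y i))
    refine .of_dotProduct_mulVec_pos hS.1 fun v hv => ?_
    refine (hS.dotProduct_mulVec_nonneg v).lt_of_ne fun h0 => hv ?_
    have hval : star v ⬝ᵥ ((∑ i, (vecMulVec (x i) (x i) + vecMulVec (y i) (y i))) *ᵥ v) =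
        ∑ i, ((x i ⬝ᵥ v) ^ 2 + (y i ⬝ᵥ v) ^ 2) := by
      rw [sum_mulVec, dotProduct_sum]
      refine Finset.sum_congr rfl fun i _ => ?_
      rw [add_mulVec, dotProduct_add, vecMulVec_mulVec, vecMulVec_mulVec, star_trivial]
      simp only [op_smul_eq_smul, smul_eq_mul, dotProduct_comm v, smul_dotProduct]
      ring
    rw [hval, eq_comm, Finset.sum_eq_zero_iff_of_nonneg fun i _ => by positivity] at h0
    have hzero : dotProductBilin ℂ ℂ (fun j => (v j : ℂ)) = 0 := b.ext fun i => by
      have hi := h0 i (Finset.mem_univ i)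
      have hxi : x i ⬝ᵥ v = 0 := by nlinarith [sq_nonneg (x i ⬝ᵥ v), sq_nonneg (y i ⬝ᵥ v)]
      have hyi : y i ⬝ᵥ v = 0 := by nlinarith [sq_nonneg (x i ⬝ᵥ v), sq_nonneg (y i ⬝ᵥ v)]
      rw [dotProduct_comm] at hxi hyi
      apply Complex.ext
      · simpa [dotProduct, x] using hxi
      · simpa [dotProduct, y] using hyi
    ext j
    simpa using LinearMap.congr_fun hzero (Pi.single j 1)
  · rw [Finset.mul_sum, Finset.sum_mul, ← Finset.sum_add_distrib]
    refine Finset.sum_eq_zero fun i _ => ?_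
    rw [Matrix.mul_add, Matrix.add_mul, mul_vecMulVec, mul_vecMulVec, vecMulVec_mul, vecMulVec_mul,
      vecMul_transpose, vecMul_transpose, hx, hy]
    ext a b
    simp [vecMulVec_apply]

end center

section gramian

open scoped ComplexOrder

variable {k q : Type*} [Fintype k] [Fintype q]

theorem posSemidef_mul_transpose_self (N : Matrix k q ℝ) : (N * Nᵀ).PosSemidef := by
  simpa using posSemidef_self_mul_conjTranspose N

/-- A positive semidefinite controllability Gramian of a controllable pair is positive definite. -/
theorem posDef_of_lyapunov_of_controllable {M S : Matrix k k ℝ} {N : Matrix k q ℝ}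
    (hS : S.PosSemidef) (h : M * S + S * Mᵀ = -(N * Nᵀ)) (hc : IsControllablePair M N) :
    S.PosDef := by
  classical
  have hSc := posSemidef_map_ofReal hS
  have h' := congrArg (fun X : Matrix k k ℝ => X.map Complex.ofReal) h
  simp only [map_ofReal_add, map_ofReal_mul, map_ofReal_neg] at h'
  have hker (w : k → ℂ) (hw : S.map Complex.ofReal *ᵥ w = 0) :
      (N.map Complex.ofReal)ᵀ *ᵥ w = 0 ∧
        S.map Complex.ofReal *ᵥ ((M.map Complex.ofReal)ᵀ *ᵥ w) = 0 := by
    have h1 := congrArg (· *ᵥ w) h'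
    simp only [add_mulVec, ← mulVec_mulVec, hw, mulVec_zero, zero_add, neg_mulVec,
      ← transpose_map] at h1 ⊢
    have h2 : star w ⬝ᵥ (S.map Complex.ofReal *ᵥ (Mᵀ.map Complex.ofReal *ᵥ w)) = 0 := by
      rw [dotProduct_mulVec, ← hSc.1.eq, ← star_mulVec, hw, star_zero, zero_dotProduct]
    have h3 : Nᵀ.map Complex.ofReal *ᵥ w = 0 := by
      rw [← dotProduct_star_self_eq_zero, ← dotProduct_star_self_mulVec,
        map_ofReal_mul, ← mulVec_mulVec, ← neg_eq_zero, ← dotProduct_neg, ← h1, h2]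
    refine ⟨h3, ?_⟩
    rw [h1, h3, mulVec_zero, neg_zero]
  have hmem (w : LinearMap.ker (toLin' (S.map Complex.ofReal))) :
      S.map Complex.ofReal *ᵥ w.1 = 0 := by
    have := LinearMap.mem_ker.mp w.2
    rwa [toLin'_apply] at this
  have hbot : LinearMap.ker (toLin' (S.map Complex.ofReal)) = ⊥ := by
    by_contra hne
    have := Submodule.nontrivial_iff_ne_bot.mpr hne
    obtain ⟨ν, hν⟩ := Module.End.exists_eigenvalue
      ((toLin' (M.map Complex.ofReal)ᵀ).restrict
        (p := LinearMap.ker (toLin' (S.map Complex.ofReal)))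
        (q := LinearMap.ker (toLin' (S.map Complex.ofReal)))
        fun w hw => by simpa using (hker w (by simpa using hw)).2)
    obtain ⟨w, hw⟩ := hν.exists_hasEigenvector
    have hw1 := congrArg Subtype.val hw.apply_eq_smul
    refine hc ν w.1 (fun h0 => hw.2 (Subtype.ext h0)) ?_ (hker w.1 (hmem w)).1
    simpa using hw1
  refine .of_dotProduct_mulVec_pos hS.1 fun v hv => ?_
  refine (hS.dotProduct_mulVec_nonneg v).lt_of_ne fun h0 => hv ?_
  have hSv := (hS.dotProduct_mulVec_zero_iff v).mp h0.symm
  have hvk : (fun i => (v i : ℂ)) ∈ LinearMap.ker (toLin' (S.map Complex.ofReal)) := by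
    rw [LinearMap.mem_ker, toLin'_apply]
    ext i
    have := congrArg Complex.ofReal (congrFun hSv i)
    simpa [mulVec, dotProduct] using this
  rw [hbot, Submodule.mem_bot] at hvk
  ext i
  simpa using congrFun hvk i

end gramian

section zeroDynamics

open scoped ComplexOrder

variable {k q : Type*} [Fintype k] [DecidableEq k] [Fintype q]

/-- The key Lyapunov inequality: it has a positive definite solution `S` for which `Hᵀ` detects
every mode of `M S`. -/
theorem exists_posDef_lyapunov_observable {M : Matrix k k ℝ} {H : Matrix k q ℝ}
    (hM : IsLyapunovStable M) (hc : IsControllablePair M H) :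
    ∃ S : Matrix k k ℝ, S.PosDef ∧ (-(M * S + S * Mᵀ)).PosSemidef ∧
      ∀ (μ : ℂ) (w : k → ℂ), w ≠ 0 →
        M.map Complex.ofReal *ᵥ (S.map Complex.ofReal *ᵥ w) =
          μ • (S.map Complex.ofReal *ᵥ w) →
        Hᵀ.map Complex.ofReal *ᵥ w ≠ 0 := by
  obtain ⟨P, hPP, hPM, hP0, hP1⟩ := exists_spectral_projection M
  set R := 1 - P with hR
  have hPR : P * R = 0 := by rw [hR, mul_sub, mul_one, hPP, sub_self]
  have hRP : R * P = 0 := by rw [hR, sub_mul, one_mul, hPP, sub_self]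
  have hRR : R * R = R := by rw [hR, mul_sub, mul_one, ← hR, hRP, sub_zero]
  have hRM : R * M = M * R := by rw [hR, mul_sub, sub_mul, hPM, mul_one, one_mul]
  have hsplit (v : k → ℂ) : P.map Complex.ofReal *ᵥ v + R.map Complex.ofReal *ᵥ v = v := by
    rw [← add_mulVec, ← map_ofReal_add, hR, add_sub_cancel, map_ofReal_one, one_mulVec]
  have hcomp {A B C : Matrix k k ℝ} (h : A * B = C) (v : k → ℂ) :
      A.map Complex.ofReal *ᵥ (B.map Complex.ofReal *ᵥ v) = C.map Complex.ofReal *ᵥ v :=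
    mulVec_map_ofReal_comp h v
  have hz (v : k → ℂ) : (0 : Matrix k k ℝ).map Complex.ofReal *ᵥ v = 0 := by
    rw [Matrix.map_zero _ Complex.ofReal_zero, zero_mulVec]
  -- the stable part
  have hPMs : P * (M * P - R) = M * P := by
    rw [mul_sub, hPR, sub_zero, ← Matrix.mul_assoc, hPM, Matrix.mul_assoc, hPP]
  have hRMs : R * (M * P - R) = -R := by
    rw [mul_sub, hRR, ← Matrix.mul_assoc, hRM, Matrix.mul_assoc, hRP, mul_zero, zero_sub]
  have hMs (μ : ℂ) (v : k → ℂ) (hv : v ≠ 0)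
      (h : (M * P - R).map Complex.ofReal *ᵥ v = μ • v) : μ.re < 0 := by
    by_cases hPv : P.map Complex.ofReal *ᵥ v = 0
    · have h1 := congrArg (R.map Complex.ofReal *ᵥ ·) h
      have hRv : R.map Complex.ofReal *ᵥ v = v := by
        have := hsplit v
        rwa [hPv, zero_add] at this
      simp only [hcomp hRMs, mulVec_smul, map_ofReal_neg, neg_mulVec, hRv] at h1
      have : (μ + 1) • v = 0 := by rw [add_smul, one_smul, ← h1, neg_add_cancel]
      have hμ := eq_neg_of_add_eq_zero_left ((smul_eq_zero.mp this).resolve_right hv)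
      rw [hμ]
      simp
    · have h1 : M.map Complex.ofReal *ᵥ (P.map Complex.ofReal *ᵥ v) =
          μ • (P.map Complex.ofReal *ᵥ v) := by
        rw [hcomp rfl, ← hPMs, ← hcomp rfl, h, mulVec_smul]
      refine lt_of_le_of_ne (hM μ ⟨_, hPv, h1⟩).1 fun h0 => hPv ?_
      have := hP0 _ _ h1 h0
      rwa [hcomp hPP] at this
  have hcs : IsControllablePair (M * P - R) (fromCols (P * H) R) := by
    intro μ w hw hMw hNw
    have h1 : (P * H)ᵀ.map Complex.ofReal *ᵥ w = 0 := by
      ext i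
      simpa [mulVec, dotProduct, -transpose_mul] using congrFun hNw (Sum.inl i)
    have h2 : Rᵀ.map Complex.ofReal *ᵥ w = 0 := by
      ext i
      simpa [mulVec, dotProduct] using congrFun hNw (Sum.inr i)
    have h3 : Pᵀ.map Complex.ofReal *ᵥ w = w := by
      have : Pᵀ = 1 - Rᵀ := by rw [hR, transpose_sub, transpose_one, sub_sub_cancel]
      rw [this, map_ofReal_sub, map_ofReal_one, sub_mulVec, h2, one_mulVec, sub_zero]
    refine hc μ w hw ?_ ?_
    · rw [← transpose_map, transpose_sub, ← hPM, transpose_mul, map_ofReal_sub, map_ofReal_mul,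
        sub_mulVec, h2, sub_zero, ← mulVec_mulVec, h3] at hMw
      rwa [← transpose_map]
    · rw [transpose_mul, map_ofReal_mul, ← mulVec_mulVec, h3] at h1
      rwa [← transpose_map]
  have hNN : fromCols (P * H) R * (fromCols (P * H) R)ᵀ = P * H * (P * H)ᵀ + R * Rᵀ := by
    rw [transpose_fromCols, fromCols_mul_fromRows]
  obtain ⟨S₁, hS₁, hLS₁⟩ := exists_lyapunov_solution
    (posSemidef_mul_transpose_self (fromCols (P * H) R)) hMs
  replace hS₁ := posDef_of_lyapunov_of_controllable hS₁ hLS₁ hcs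
  rw [hNN] at hLS₁
  -- the purely imaginary part
  have hRMc : R * (M * R) = M * R := by rw [← Matrix.mul_assoc, hRM, Matrix.mul_assoc, hRR]
  have hPMc : P * (M * R) = 0 := by rw [← Matrix.mul_assoc, hPM, Matrix.mul_assoc, hPR, mul_zero]
  have hPRv (v : k → ℂ) : P.map Complex.ofReal *ᵥ (R.map Complex.ofReal *ᵥ v) = 0 := by
    rw [hcomp hPR, hz]
  obtain ⟨S₂, hS₂, hLS₂⟩ := exists_posDef_lyapunov_eq_zero (M := M * R) (by
    intro μ v hv h
    by_cases hRv : R.map Complex.ofReal *ᵥ v = 0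
    · rw [← hcomp rfl, hRv, mulVec_zero, eq_comm, smul_eq_zero] at h
      rw [h.resolve_right hv, Complex.zero_re]
    · by_contra hμ
      have h1 : M.map Complex.ofReal *ᵥ (R.map Complex.ofReal *ᵥ v) =
          μ • (R.map Complex.ofReal *ᵥ v) := by
        rw [hcomp rfl, ← hRMc, ← hcomp rfl, h, mulVec_smul]
      have := hP1 _ _ h1 hμ
      rw [hPRv] at this
      exact hRv this.symm) (by
    intro μ v h
    have hPx (x : k → ℂ) : P.map Complex.ofReal *ᵥ (((M * R).map Complex.ofReal - μ • 1) *ᵥ x) =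
        (-μ) • (P.map Complex.ofReal *ᵥ x) := by
      rw [sub_mulVec, mulVec_sub, hcomp hPMc, hz, smul_mulVec, one_mulVec, mulVec_smul, zero_sub,
        neg_smul]
    have hRx (x : k → ℂ) : R.map Complex.ofReal *ᵥ (((M * R).map Complex.ofReal - μ • 1) *ᵥ x) =
        (M.map Complex.ofReal - μ • 1) *ᵥ (R.map Complex.ofReal *ᵥ x) := by
      rw [sub_mulVec, mulVec_sub, hcomp hRMc, ← hcomp rfl, smul_mulVec, one_mulVec, mulVec_smul,
        sub_mulVec, smul_mulVec, one_mulVec]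
    rw [← hsplit (((M * R).map Complex.ofReal - μ • 1) *ᵥ v)]
    have h1 : P.map Complex.ofReal *ᵥ (((M * R).map Complex.ofReal - μ • 1) *ᵥ v) = 0 := by
      have := congrArg (P.map Complex.ofReal *ᵥ ·) h
      simp only [hPx, mulVec_zero, smul_smul] at this
      rw [hPx]
      rcases smul_eq_zero.mp this with h0 | h0
      · rw [mul_self_eq_zero.mp h0, zero_smul]
      · rw [h0, smul_zero]
    have h2 : R.map Complex.ofReal *ᵥ (((M * R).map Complex.ofReal - μ • 1) *ᵥ v) = 0 := by
      have h3 := congrArg (R.map Complex.ofReal *ᵥ ·) h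
      simp only [hRx, mulVec_zero] at h3
      by_contra hne
      have hPu := hPRv (((M * R).map Complex.ofReal - μ • 1) *ᵥ v)
      rw [hRx] at hne hPu
      have h4 : M.map Complex.ofReal *ᵥ
          ((M.map Complex.ofReal - μ • 1) *ᵥ (R.map Complex.ofReal *ᵥ v)) =
          μ • ((M.map Complex.ofReal - μ • 1) *ᵥ (R.map Complex.ofReal *ᵥ v)) := by
        rw [sub_mulVec (M.map Complex.ofReal) _ ((M.map Complex.ofReal - μ • 1) *ᵥ _),
          smul_mulVec, one_mulVec] at h3
        exact sub_eq_zero.mp h3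
      by_cases hμ : μ.re = 0
      · exact hne ((hM μ ⟨_, hne, h4⟩).2 hμ _ h3)
      · have := hP1 _ _ h4 hμ
        rw [hPu] at this
        exact hne this.symm
    rw [h1, h2, add_zero])
  -- assembling the two parts
  have hLS : M * (P * S₁ * Pᵀ + R * S₂ * Rᵀ) + (P * S₁ * Pᵀ + R * S₂ * Rᵀ) * Mᵀ =
      -(P * H * (P * H)ᵀ) := by
    have e1 : M * (P * S₁ * Pᵀ) + P * S₁ * Pᵀ * Mᵀ =
        P * ((M * P - R) * S₁ + S₁ * (M * P - R)ᵀ) * Pᵀ := by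
      have : Pᵀ * Mᵀ = (M * P - R)ᵀ * Pᵀ := by rw [← transpose_mul, ← transpose_mul, hPMs]
      rw [mul_add, add_mul, ← Matrix.mul_assoc P (M * P - R), hPMs]
      simp only [Matrix.mul_assoc, this]
    have e2 : M * (R * S₂ * Rᵀ) + R * S₂ * Rᵀ * Mᵀ =
        R * ((M * R) * S₂ + S₂ * (M * R)ᵀ) * Rᵀ := by
      have : Rᵀ * Mᵀ = (M * R)ᵀ * Rᵀ := by rw [← transpose_mul, ← transpose_mul, hRMc]
      rw [mul_add, add_mul, ← Matrix.mul_assoc R (M * R), hRMc]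
      simp only [Matrix.mul_assoc, this]
    have e3 : M * (P * S₁ * Pᵀ + R * S₂ * Rᵀ) + (P * S₁ * Pᵀ + R * S₂ * Rᵀ) * Mᵀ =
        (M * (P * S₁ * Pᵀ) + P * S₁ * Pᵀ * Mᵀ) + (M * (R * S₂ * Rᵀ) + R * S₂ * Rᵀ * Mᵀ) := by
      rw [mul_add, add_mul]
      abel
    rw [e3, e1, e2, hLS₁, hLS₂, mul_zero, zero_mul, add_zero, mul_neg, neg_mul, mul_add,
      ← Matrix.mul_assoc P R, hPR, zero_mul, add_zero]
    simp only [transpose_mul, ← Matrix.mul_assoc, hPP]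
    rw [Matrix.mul_assoc _ Pᵀ Pᵀ, ← transpose_mul, hPP]
  have hpsd₁ : (P * S₁ * Pᵀ).PosSemidef := by
    simpa using hS₁.posSemidef.mul_mul_conjTranspose_same P
  have hpsd₂ : (R * S₂ * Rᵀ).PosSemidef := by
    simpa using hS₂.posSemidef.mul_mul_conjTranspose_same R
  have hS : (P * S₁ * Pᵀ + R * S₂ * Rᵀ).PosDef := by
    have hform (X Y : Matrix k k ℝ) (v : k → ℝ) :
        star v ⬝ᵥ ((X * Y * Xᵀ) *ᵥ v) = star (Xᵀ *ᵥ v) ⬝ᵥ (Y *ᵥ (Xᵀ *ᵥ v)) := by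
      rw [star_trivial, star_trivial, ← mulVec_mulVec, ← mulVec_mulVec, dotProduct_mulVec,
        ← mulVec_transpose]
    refine .of_dotProduct_mulVec_pos (hpsd₁.add hpsd₂).1 fun v hv => ?_
    rw [add_mulVec, dotProduct_add]
    by_cases hPv : Pᵀ *ᵥ v = 0
    · have hRv : Rᵀ *ᵥ v ≠ 0 := by
        rwa [hR, transpose_sub, transpose_one, sub_mulVec, one_mulVec, hPv, sub_zero]
      refine add_pos_of_nonneg_of_pos (hpsd₁.dotProduct_mulVec_nonneg v) ?_
      rw [hform]
      exact hS₂.dotProduct_mulVec_pos hRv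
    · refine add_pos_of_pos_of_nonneg ?_ (hpsd₂.dotProduct_mulVec_nonneg v)
      rw [hform]
      exact hS₁.dotProduct_mulVec_pos hPv
  have hQ : (-(M * (P * S₁ * Pᵀ + R * S₂ * Rᵀ) +
      (P * S₁ * Pᵀ + R * S₂ * Rᵀ) * Mᵀ)).PosSemidef := by
    rw [hLS, neg_neg]
    exact posSemidef_mul_transpose_self _
  refine ⟨P * S₁ * Pᵀ + R * S₂ * Rᵀ, hS, hQ, fun μ w hw h hHw => ?_⟩
  have h0 : (M * (P * S₁ * Pᵀ + R * S₂ * Rᵀ) +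
      (P * S₁ * Pᵀ + R * S₂ * Rᵀ) * Mᵀ).map Complex.ofReal *ᵥ w = 0 := by
    by_cases hμ : μ.re = 0
    · exact lyapunov_mulVec_eq_zero hS hQ hμ h
    · have h1 := hP1 _ _ h hμ
      have hRS : R * (P * S₁ * Pᵀ + R * S₂ * Rᵀ) = R * S₂ * Rᵀ := by
        simp only [mul_add, ← Matrix.mul_assoc, hRP, hRR, zero_mul, zero_add]
      have h2 : (R * S₂ * Rᵀ).map Complex.ofReal *ᵥ w = 0 := by
        rw [← hRS, ← hcomp rfl]
        have := hsplit ((P * S₁ * Pᵀ + R * S₂ * Rᵀ).map Complex.ofReal *ᵥ w)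
        rw [h1] at this
        exact left_eq_add.mp this.symm
      have h3 : Rᵀ.map Complex.ofReal *ᵥ w = 0 := by
        by_contra hne
        have hpos := (posDef_map_ofReal hS₂).dotProduct_mulVec_pos hne
        rw [star_mulVec, conjTranspose_map_ofReal, transpose_transpose, ← dotProduct_mulVec,
          hcomp rfl, hcomp rfl, h2, dotProduct_zero] at hpos
        exact lt_irrefl _ hpos
      have h4 : Pᵀ.map Complex.ofReal *ᵥ w = w := by
        have : Pᵀ = 1 - Rᵀ := by rw [hR, transpose_sub, transpose_one, sub_sub_cancel]
        rw [this, map_ofReal_sub, map_ofReal_one, sub_mulVec, h3, one_mulVec, sub_zero]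
      rw [hLS, map_ofReal_neg, neg_mulVec, map_ofReal_mul, ← mulVec_mulVec, transpose_mul,
        map_ofReal_mul Hᵀ, ← mulVec_mulVec w, h4, hHw, mulVec_zero, neg_zero]
  refine hc (-μ) w hw (transpose_mulVec_eq_of_lyapunov_mulVec_eq_zero hS h h0) ?_
  rwa [← transpose_map]

end zeroDynamics

section feedback

variable {n p : Type*} [Fintype n] [Fintype p]

theorem transpose_add_mul_mulVec {A : Matrix n n ℝ} {B : Matrix n p ℝ} (K : Matrix p n ℝ)
    {v : n → ℂ} (hv : (B.map Complex.ofReal)ᵀ *ᵥ v = 0) :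
    ((A + B * K).map Complex.ofReal)ᵀ *ᵥ v = (A.map Complex.ofReal)ᵀ *ᵥ v := by
  rw [map_ofReal_add, map_ofReal_mul, transpose_add, transpose_mul, add_mulVec, ← mulVec_mulVec,
    hv, mulVec_zero, add_zero]

/-- Controllability is invariant under regular state feedback. -/
theorem isControllablePair_feedback_iff [DecidableEq p] {A : Matrix n n ℝ} {B : Matrix n p ℝ}
    (K : Matrix p n ℝ) {L : Matrix p p ℝ} (hL : IsUnit L.det) :
    IsControllablePair (A + B * K) (B * L) ↔ IsControllablePair A B := by
  have hBL (v : n → ℂ) :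
      ((B * L).map Complex.ofReal)ᵀ *ᵥ v = 0 ↔ (B.map Complex.ofReal)ᵀ *ᵥ v = 0 := by
    have h1 : ((B * L).map Complex.ofReal)ᵀ *ᵥ v =
        Lᵀ.map Complex.ofReal *ᵥ ((B.map Complex.ofReal)ᵀ *ᵥ v) := by
      rw [map_ofReal_mul, transpose_mul, ← mulVec_mulVec, transpose_map]
    rw [h1]
    refine ⟨fun h => ?_, fun h => by rw [h, mulVec_zero]⟩
    have h2 := congrArg (L⁻¹ᵀ.map Complex.ofReal *ᵥ ·) h
    simp only [mulVec_zero] at h2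
    rwa [mulVec_map_ofReal_comp (L := 1) (by
      rw [← transpose_mul, mul_nonsing_inv _ hL, transpose_one]), map_ofReal_one, one_mulVec] at h2
  refine forall_congr' fun μ => forall_congr' fun v => forall_congr' fun _ => ?_
  rw [Ne, hBL, Ne]
  constructor <;> intro h h1 h2
  · exact h (by rw [transpose_add_mul_mulVec K h2, h1]) h2
  · exact h (by rw [← transpose_add_mul_mulVec K h2, h1]) h2

variable {m : Type*} [Fintype m] [DecidableEq m]
  {A : Matrix n n ℝ} {B : Matrix n p ℝ} {C : Matrix p n ℝ} {Cz : Matrix m n ℝ}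
  {Rz : Matrix n m ℝ} {Ry : Matrix n p ℝ} {Az : Matrix m m ℝ} {H : Matrix m p ℝ}

/-- Zero dynamics of an NI closed loop are Lyapunov stable. -/
theorem isLyapunovStable_zeroDynamics (hCzRz : Cz * Rz = 1) (hCRz : C * Rz = 0)
    (hCzB : Cz * B = 0) (hAz : IsUnit Az.det) (hCzA : Cz * A = Az * (Cz + H * C))
    {K : Matrix p n ℝ} {L : Matrix p p ℝ} {Y : Matrix n n ℝ} (hY : Y.PosDef)
    (hQ : (-((A + B * K) * Y + Y * (A + B * K)ᵀ)).PosSemidef)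
    (hNI : B * L + (A + B * K) * Y * Cᵀ = 0) : IsLyapunovStable Az := by
  set W := Cz + H * C with hW
  have hWRz : W * Rz = 1 := by
    rw [hW, Matrix.add_mul, Matrix.mul_assoc, hCRz, hCzRz, Matrix.mul_zero, add_zero]
  have hCzAcl : Cz * (A + B * K) = Az * W := by
    rw [Matrix.mul_add, ← Matrix.mul_assoc, hCzB, Matrix.zero_mul, add_zero, hCzA]
  have hAzW : Az * (W * Y * Cᵀ) = 0 := by
    have h := congrArg (Cz * ·) hNI
    rw [Matrix.mul_add, ← Matrix.mul_assoc, hCzB, Matrix.zero_mul, zero_add, Matrix.mul_zero,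
      Matrix.mul_assoc (A + B * K), ← Matrix.mul_assoc Cz, hCzAcl] at h
    simpa only [Matrix.mul_assoc] using h
  have hWYC : W * Y * Cᵀ = 0 := by
    rw [← nonsing_inv_mul_cancel_left Az (W * Y * Cᵀ) hAz, hAzW, Matrix.mul_zero]
  have hS : W * Y * Wᵀ = W * Y * Czᵀ := by
    have : Wᵀ = Czᵀ + Cᵀ * Hᵀ := by rw [hW, transpose_add, transpose_mul]
    rw [this, Matrix.mul_add, ← Matrix.mul_assoc, hWYC, Matrix.zero_mul, add_zero]
  have hYt : Yᵀ = Y := by simpa using hY.1.eq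
  have hS' : W * Y * Wᵀ = Cz * Y * Wᵀ := by
    have := congrArg transpose hS
    simpa [transpose_mul, hYt, Matrix.mul_assoc] using this
  have hSpos : (W * Y * Wᵀ).PosDef := by
    have := hY.mul_mul_conjTranspose_same (B := W) (fun x y hxy => by
      have := congrArg (· ᵥ* Rz) hxy
      simpa [vecMul_vecMul, hWRz] using this)
    simpa using this
  refine isLyapunovStable_of_lyapunov hSpos ?_
  have h1 : Az * (W * Y * Wᵀ) = Cz * ((A + B * K) * Y) * Czᵀ := by
    rw [hS, ← Matrix.mul_assoc Cz, hCzAcl]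
    simp only [Matrix.mul_assoc]
  have h2 : W * Y * Wᵀ * Azᵀ = Cz * (Y * (A + B * K)ᵀ) * Czᵀ := by
    rw [hS', Matrix.mul_assoc, ← transpose_mul, ← hCzAcl, transpose_mul]
    simp only [Matrix.mul_assoc]
  rw [h1, h2, ← Matrix.add_mul, ← Matrix.mul_add, ← Matrix.neg_mul, ← Matrix.mul_neg]
  simpa using hQ.mul_mul_conjTranspose_same Cz

/-- The input matrix of the zero dynamics inherits controllability. -/
theorem isControllablePair_zeroDynamics (hCzRz : Cz * Rz = 1)
    (hCzB : Cz * B = 0) (hCzA : Cz * A = Az * (Cz + H * C)) (hc : IsControllablePair A B) :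
    IsControllablePair Az H := by
  intro μ v hv hAv hHv
  simp only [← transpose_map] at hAv hHv
  refine hc μ (Czᵀ.map Complex.ofReal *ᵥ v) (fun h0 => hv ?_) ?_ ?_
  · have := congrArg (Rzᵀ.map Complex.ofReal *ᵥ ·) h0
    simpa only [mulVec_zero, mulVec_map_ofReal_comp (L := 1) (M := Rzᵀ) (N := Czᵀ)
      (by rw [← transpose_mul, hCzRz, transpose_one]), map_ofReal_one, one_mulVec] using this
  · have h : Aᵀ * Czᵀ = Czᵀ * Azᵀ + Cᵀ * (Hᵀ * Azᵀ) := by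
      rw [← transpose_mul, hCzA]
      simp only [transpose_mul, transpose_add, Matrix.add_mul, Matrix.mul_assoc]
    rw [← transpose_map, mulVec_map_ofReal_comp h, map_ofReal_add, add_mulVec, map_ofReal_mul,
      map_ofReal_mul, map_ofReal_mul, ← mulVec_mulVec, ← mulVec_mulVec, ← mulVec_mulVec, hAv,
      mulVec_smul, mulVec_smul, hHv, smul_zero, mulVec_zero, add_zero]
  · rw [← transpose_map, mulVec_map_ofReal_comp (L := 0)
      (by rw [← transpose_mul, hCzB, transpose_zero]), Matrix.map_zero _ Complex.ofReal_zero,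
      zero_mulVec]

/-- State feedback rendering a weakly minimum phase system NI. -/
theorem exists_NI_feedback [DecidableEq n] [DecidableEq p] (hCzRz : Cz * Rz = 1)
    (hCRz : C * Rz = 0) (hCzRy : Cz * Ry = 0)
    (hCRy : C * Ry = 1) (hone : Rz * Cz + Ry * C = 1) (hCB : IsUnit (C * B).det)
    (hCzB : Cz * B = 0) (hAz : Az.det ≠ 0) (hCzA : Cz * A = Az * (Cz + H * C))
    (hc : IsControllablePair A B) (hst : IsLyapunovStable Az) :
    ∃ (K : Matrix p n ℝ) (L : Matrix p p ℝ), IsUnit L.det ∧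
      IsControllablePair (A + B * K) (B * L) ∧ IsObservablePair (A + B * K) C ∧
      (A + B * K).det ≠ 0 ∧
      ∃ Y : Matrix n n ℝ, Y.PosDef ∧ (-((A + B * K) * Y + Y * (A + B * K)ᵀ)).PosSemidef ∧
        B * L + (A + B * K) * Y * Cᵀ = 0 := by
  obtain ⟨S, hS, hQ, hobs⟩ := exists_posDef_lyapunov_observable hst
    (isControllablePair_zeroDynamics hCzRz hCzB hCzA hc)
  have hSu : IsUnit S.det := hS.det_pos.ne'.isUnit
  have hSt : Sᵀ = S := by simpa using hS.1.eq
  set W := Cz + H * C with hW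
  set N := Ry - Rz * H with hN
  have hWRz : W * Rz = 1 := by
    rw [hW, Matrix.add_mul, Matrix.mul_assoc, hCRz, hCzRz, Matrix.mul_zero, add_zero]
  have hWN : W * N = 0 := by
    rw [hN, Matrix.mul_sub, ← Matrix.mul_assoc, hWRz, Matrix.one_mul, hW, Matrix.add_mul, hCzRy,
      Matrix.mul_assoc, hCRy, Matrix.mul_one, zero_add, sub_self]
  have hCN : C * N = 1 := by
    rw [hN, Matrix.mul_sub, ← Matrix.mul_assoc, hCRz, hCRy, Matrix.zero_mul, sub_zero]
  have hone' : Rz * W + N * C = 1 := by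
    rw [← hone, hW, hN, Matrix.mul_add, Matrix.sub_mul, Matrix.mul_assoc]
    abel
  have hB : B * (C * B)⁻¹ = Ry := by
    have h : B = Ry * (C * B) := by
      conv_lhs => rw [← Matrix.one_mul B, ← hone, Matrix.add_mul, Matrix.mul_assoc, hCzB,
        Matrix.mul_zero, zero_add, Matrix.mul_assoc]
    conv_lhs => lhs; rw [h]
    rw [mul_nonsing_inv_cancel_right _ _ hCB]
  have hLu : IsUnit ((C * B)⁻¹).det := isUnit_nonsing_inv_det _ hCB
  set Y := Rz * S * Rzᵀ + N * Nᵀ with hYdef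
  set K := -((C * B)⁻¹ * (Hᵀ * S⁻¹ * W + C + C * A)) with hK
  have hBK : B * K = -(Ry * (Hᵀ * S⁻¹ * W + C + C * A)) := by
    rw [hK, Matrix.mul_neg, ← Matrix.mul_assoc, hB]
  have hAcl : A + B * K = Rz * Az * W - Ry * (Hᵀ * S⁻¹ * W + C) := by
    have hA : A = Rz * Az * W + Ry * (C * A) := by
      conv_lhs => rw [← Matrix.one_mul A, ← hone, Matrix.add_mul, Matrix.mul_assoc, hCzA,
        Matrix.mul_assoc, ← Matrix.mul_assoc]
    rw [hBK, Matrix.mul_add Ry _ (C * A)]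
    conv_lhs => lhs; rw [hA]
    abel
  have hWY : W * Y = S * Rzᵀ := by
    rw [hYdef, Matrix.mul_add, ← Matrix.mul_assoc, ← Matrix.mul_assoc, hWRz, Matrix.one_mul,
      ← Matrix.mul_assoc, hWN, Matrix.zero_mul, add_zero]
  have hCY : C * Y = Nᵀ := by
    rw [hYdef, Matrix.mul_add, ← Matrix.mul_assoc, ← Matrix.mul_assoc, hCRz, Matrix.zero_mul,
      Matrix.zero_mul, ← Matrix.mul_assoc, hCN, Matrix.one_mul, zero_add]
  have hAclY : (A + B * K) * Y = Rz * (Az * S) * Rzᵀ - Ry * Ryᵀ := by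
    have h1 : Hᵀ * S⁻¹ * W * Y + C * Y = Ryᵀ := by
      rw [Matrix.mul_assoc, hWY, hCY, ← Matrix.mul_assoc, nonsing_inv_mul_cancel_right _ _ hSu,
        hN, transpose_sub, transpose_mul, add_sub_cancel]
    rw [hAcl, Matrix.sub_mul, Matrix.mul_assoc _ W, hWY, Matrix.mul_assoc Ry, Matrix.add_mul, h1]
    simp only [Matrix.mul_assoc]
  have hYt : Yᵀ = Y := by
    simp only [hYdef, transpose_add, transpose_mul, transpose_transpose, hSt, Matrix.mul_assoc]
  have hCzAcl : Cz * (A + B * K) = Az * W := by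
    rw [Matrix.mul_add, ← Matrix.mul_assoc, hCzB, Matrix.zero_mul, add_zero, hCzA]
  have hCAcl : C * (A + B * K) = -(Hᵀ * S⁻¹ * W + C) := by
    rw [hAcl, Matrix.mul_sub, ← Matrix.mul_assoc, ← Matrix.mul_assoc, hCRz, Matrix.zero_mul,
      Matrix.zero_mul, ← Matrix.mul_assoc, hCRy, Matrix.one_mul, zero_sub]
  refine ⟨K, (C * B)⁻¹, hLu, (isControllablePair_feedback_iff K hLu).mpr hc, ?_, ?_, Y, ?_, ?_, ?_⟩
  · intro μ v hv hAv hCv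
    have hWv : W.map Complex.ofReal *ᵥ v = Cz.map Complex.ofReal *ᵥ v := by
      rw [hW, map_ofReal_add, add_mulVec, map_ofReal_mul, ← mulVec_mulVec, hCv, mulVec_zero,
        add_zero]
    have hRzW : Rz.map Complex.ofReal *ᵥ (W.map Complex.ofReal *ᵥ v) = v := by
      have := congrArg (fun X : Matrix n n ℝ => X.map Complex.ofReal *ᵥ v) hone'
      simpa only [map_ofReal_add, add_mulVec, map_ofReal_mul, ← mulVec_mulVec, hCv, mulVec_zero,
        add_zero, map_ofReal_one, one_mulVec] using this
    have hSw : S.map Complex.ofReal *ᵥ (S⁻¹.map Complex.ofReal *ᵥ (W.map Complex.ofReal *ᵥ v)) =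
        W.map Complex.ofReal *ᵥ v := by
      rw [mulVec_map_ofReal_comp (mul_nonsing_inv _ hSu), map_ofReal_one, one_mulVec]
    refine hobs μ (S⁻¹.map Complex.ofReal *ᵥ (W.map Complex.ofReal *ᵥ v)) (fun h0 => hv ?_) ?_ ?_
    · rw [← hRzW, ← hSw, h0, mulVec_zero, mulVec_zero]
    · rw [hSw, mulVec_map_ofReal_comp hCzAcl.symm, map_ofReal_mul, ← mulVec_mulVec, hAv,
        mulVec_smul, hWv]
    · have h := congrArg (C.map Complex.ofReal *ᵥ ·) hAv
      simp only [mulVec_smul, hCv, smul_zero] at h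
      rw [mulVec_map_ofReal_comp hCAcl, map_ofReal_neg, neg_mulVec, map_ofReal_add, add_mulVec,
        hCv, add_zero, neg_eq_zero] at h
      rwa [mulVec_map_ofReal_comp rfl, mulVec_map_ofReal_comp rfl]
  · intro h0
    obtain ⟨v, hv, hAv⟩ := exists_mulVec_eq_zero_iff.mpr h0
    have h1 := congrArg (Cz *ᵥ ·) hAv
    have h2 := congrArg (C *ᵥ ·) hAv
    simp only [mulVec_mulVec, hCzAcl, hCAcl, mulVec_zero] at h1 h2
    rw [← mulVec_mulVec] at h1
    have hWv := eq_zero_of_mulVec_eq_zero hAz h1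
    rw [neg_mulVec, neg_eq_zero, add_mulVec, ← mulVec_mulVec, hWv, mulVec_zero, zero_add] at h2
    apply hv
    rw [← one_mulVec v, ← hone', add_mulVec, ← mulVec_mulVec, ← mulVec_mulVec, hWv, h2,
      mulVec_zero, mulVec_zero, add_zero]
  · have hpsd₁ : (Rz * S * Rzᵀ).PosSemidef := by
      simpa using hS.posSemidef.mul_mul_conjTranspose_same Rz
    have hpsd := hpsd₁.add (posSemidef_mul_transpose_self N)
    refine hpsd.posDef_iff_isUnit.mpr ?_
    rw [isUnit_iff_isUnit_det, isUnit_iff_ne_zero]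
    intro h0
    obtain ⟨v, hv, hYv⟩ := exists_mulVec_eq_zero_iff.mpr h0
    have h1 := congrArg (W *ᵥ ·) hYv
    have h2 := congrArg (C *ᵥ ·) hYv
    simp only [mulVec_mulVec, ← hYdef, hWY, hCY, mulVec_zero] at h1 h2
    rw [← mulVec_mulVec] at h1
    have hRv := eq_zero_of_mulVec_eq_zero hS.det_pos.ne' h1
    apply hv
    rw [← one_mulVec v, ← transpose_one, ← hone', transpose_add, transpose_mul, transpose_mul,
      add_mulVec, ← mulVec_mulVec, ← mulVec_mulVec, hRv, h2, mulVec_zero, mulVec_zero, add_zero]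
  · have h1 : Y * (A + B * K)ᵀ = ((A + B * K) * Y)ᵀ := by rw [transpose_mul, hYt]
    have h2 : -((A + B * K) * Y + Y * (A + B * K)ᵀ) =
        Rz * (-(Az * S + S * Azᵀ)) * Rzᵀ + (Ry * Ryᵀ + Ry * Ryᵀ) := by
      rw [h1, hAclY]
      simp only [transpose_sub, transpose_mul, transpose_transpose, hSt, Matrix.mul_neg,
        Matrix.neg_mul, Matrix.mul_add, Matrix.add_mul, Matrix.mul_assoc]
      abel
    rw [h2]
    have h3 : (Rz * (-(Az * S + S * Azᵀ)) * Rzᵀ).PosSemidef := by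
      simpa only [conjTranspose_eq_transpose_of_trivial] using hQ.mul_mul_conjTranspose_same Rz
    exact h3.add ((posSemidef_mul_transpose_self Ry).add (posSemidef_mul_transpose_self Ry))
  · rw [hB, hAclY, Matrix.sub_mul, Matrix.mul_assoc _ Rzᵀ, ← transpose_mul, hCRz, transpose_zero,
      Matrix.mul_zero, Matrix.mul_assoc, ← transpose_mul, hCRy, transpose_one, Matrix.mul_one,
      zero_sub, add_neg_cancel]

end feedback

/-- Main theorem, relative degree one case: a system `(𝒜, ℬ, 𝒞)` of relative degree one
with no zero at the origin is state feedback equivalent (`u = K_x x + K_v v`) to a minimal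
NI system iff it is controllable and weakly minimum phase (the zero dynamics matrix `A11`
is Lyapunov stable). -/
theorem main_NI_state_feedback_equivalence_relative_degree_one
    (n p : ℕ) (hpn : p ≤ n)
    (𝒜 : Matrix (Fin n) (Fin n) ℝ) (ℬ : Matrix (Fin n) (Fin p) ℝ)
    (𝒞 : Matrix (Fin p) (Fin n) ℝ) (hCB : (𝒞 * ℬ).det ≠ 0)
    (𝒞z : Matrix (Fin (n - p)) (Fin n) ℝ) (h𝒞z : 𝒞z * ℬ = 0)
    (T : Matrix (Fin n) (Fin n) ℝ)
    (hTdef : T = (Matrix.fromRows 𝒞z 𝒞).submatrix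
      (finSumFinEquiv.trans (finCongr (Nat.sub_add_cancel hpn))).symm id)
    (hT : IsUnit T)
    (A11 : Matrix (Fin (n - p)) (Fin (n - p)) ℝ)
    (hA11def : A11 = ((T * 𝒜 * T⁻¹).submatrix
      (⇑(finSumFinEquiv.trans (finCongr (Nat.sub_add_cancel hpn))))
      (⇑(finSumFinEquiv.trans (finCongr (Nat.sub_add_cancel hpn))))).toBlocks₁₁)
    (hA11 : A11.det ≠ 0) :
    (∃ (Kx : Matrix (Fin p) (Fin n) ℝ) (Kv : Matrix (Fin p) (Fin p) ℝ),
      IsUnit Kv.det ∧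
      IsControllablePair (𝒜 + ℬ * Kx) (ℬ * Kv) ∧
      IsObservablePair (𝒜 + ℬ * Kx) 𝒞 ∧
      (𝒜 + ℬ * Kx).det ≠ 0 ∧
      ∃ Y : Matrix (Fin n) (Fin n) ℝ, Y.PosDef ∧
        (-((𝒜 + ℬ * Kx) * Y + Y * (𝒜 + ℬ * Kx)ᵀ)).PosSemidef ∧
        ℬ * Kv + (𝒜 + ℬ * Kx) * Y * 𝒞ᵀ = 0) ↔
    (IsControllablePair 𝒜 ℬ ∧ IsLyapunovStable A11) := by
  set e := finSumFinEquiv.trans (finCongr (Nat.sub_add_cancel hpn))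
  set R := T⁻¹.submatrix id e with hR
  have hdet : IsUnit T.det := (isUnit_iff_isUnit_det T).mp hT
  have hTe : T.submatrix e id = fromRows 𝒞z 𝒞 := by
    rw [hTdef, submatrix_submatrix]
    simp
  have hTR : fromRows 𝒞z 𝒞 * R = 1 := by
    rw [← hTe, hR, ← submatrix_mul _ _ _ id _ Function.bijective_id, mul_nonsing_inv _ hdet,
      submatrix_one_equiv]
  have hRT : R * fromRows 𝒞z 𝒞 = 1 := by
    rw [← hTe, hR, submatrix_mul_equiv T⁻¹ T id e id, nonsing_inv_mul _ hdet, submatrix_id_id]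
  rw [← fromCols_toCols R, fromRows_mul_fromCols, ← fromBlocks_one, fromBlocks_inj] at hTR
  rw [← fromCols_toCols R, fromCols_mul_fromRows] at hRT
  obtain ⟨hCzRz, hCzRy, hCRz, hCRy⟩ := hTR
  have hA11eq : A11 = 𝒞z * 𝒜 * R.toCols₁ := by
    have h1 : (T * 𝒜 * T⁻¹).submatrix e e = fromRows 𝒞z 𝒞 * 𝒜 * fromCols R.toCols₁ R.toCols₂ := by
      rw [fromCols_toCols, ← hTe, hR]
      ext i j
      simp [mul_apply]
    rw [hA11def, h1, fromRows_mul, fromRows_mul_fromCols, toBlocks_fromBlocks₁₁]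
  have hCzA : 𝒞z * 𝒜 = A11 * (𝒞z + A11⁻¹ * (𝒞z * 𝒜 * R.toCols₂) * 𝒞) := by
    rw [Matrix.mul_add, Matrix.mul_assoc A11⁻¹, mul_nonsing_inv_cancel_left _ _ hA11.isUnit, hA11eq]
    conv_lhs => rw [← Matrix.mul_one (𝒞z * 𝒜), ← hRT, Matrix.mul_add]
    simp only [Matrix.mul_assoc]
  constructor
  · rintro ⟨Kx, Kv, hKv, hc, -, -, Y, hY, hQ, hNI⟩
    exact ⟨(isControllablePair_feedback_iff Kx hKv).mp hc,
      isLyapunovStable_zeroDynamics hCzRz hCRz h𝒞z hA11.isUnit hCzA hY hQ hNI⟩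
  · rintro ⟨hc, hst⟩
    exact exists_NI_feedback hCzRz hCRz hCzRy hCRy hRT hCB.isUnit h𝒞z hA11 hCzA hc hst
end

section
/- Let 𝒜 ∈ ℝ^{n×n}, ℬ ∈ ℝ^{n×p}, 𝒞 ∈ ℝ^{p×n} with det(𝒞ℬ) ≠ 0 (relative degree one) and the pair (𝒜, ℬ) controllable. Let 𝒞_z ∈ ℝ^{(n−p)×n} satisfy 𝒞_zℬ = 0 with T = [𝒞_z; 𝒞] invertible, and let A11 ∈ ℝ^{(n−p)×(n−p)} be the top-left block of T𝒜T^{−1} (the zero dynamics matrix). Then the following are equivalent: (i) A11 is Hurwitz (the system is minimum phase); (ii) there exist K_x ∈ ℝ^{p×n} and an invertible K_v ∈ ℝ^{p×p} such that 𝒜 + ℬK_x is Hurwitz and there exists a symmetric positive definite Y ∈ ℝ^{n×n} with (𝒜 + ℬK_x)Y + Y(𝒜 + ℬK_x)ᵀ negative definite and ℬK_v + (𝒜 + ℬK_x)Y𝒞ᵀ = 0. -/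
open Matrix

/-- A real square matrix is Hurwitz if every eigenvalue (over `ℂ`) has negative real part. -/
def IsHurwitz {k : Type*} [Fintype k] (M : Matrix k k ℝ) : Prop :=
  ∀ μ : ℂ, (∃ v : k → ℂ, v ≠ 0 ∧ (M.map Complex.ofReal) *ᵥ v = μ • v) → μ.re < 0

section Hurwitz

variable {k : Type*} [Fintype k] [DecidableEq k]

theorem mem_spectrum_iff_exists_mulVec_eq_smul {K : Type*} [Field K] (M : Matrix k k K) (μ : K) :
    μ ∈ spectrum K M ↔ ∃ v : k → K, v ≠ 0 ∧ M *ᵥ v = μ • v := by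
  rw [spectrum.mem_iff, isUnit_iff_isUnit_det, isUnit_iff_ne_zero, not_not,
    ← exists_mulVec_eq_zero_iff]
  simp only [sub_mulVec, sub_eq_zero, Algebra.algebraMap_eq_smul_one, smul_mulVec, one_mulVec,
    eq_comm]

theorem IsHurwitz.isUnit_det {M : Matrix k k ℝ} (hM : IsHurwitz M) :
    IsUnit M.det := by
  rw [isUnit_iff_ne_zero]
  intro h
  have hdet : (M.map Complex.ofReal).det = 0 := by
    have := RingHom.map_det Complex.ofRealHom M
    rw [h] at this
    exact this.symm.trans Complex.ofReal_zero
  obtain ⟨v, hv, hMv⟩ := exists_mulVec_eq_zero_iff.2 hdet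
  simpa using hM 0 ⟨v, hv, by simpa using hMv⟩

/-- Lyapunov's criterion, in the form `M S + S Mᵀ ≺ 0` with `S ≻ 0`. -/
theorem isHurwitz_of_lyapunov {M S : Matrix k k ℝ} (hS : S.PosDef)
    (hL : (-(M * S + S * Mᵀ)).PosDef) : IsHurwitz M := by
  rintro μ ⟨v, hv, hMv⟩
  have hSinv : IsUnit S.det := (isUnit_iff_isUnit_det _).1 hS.isUnit
  have hX : S⁻¹.PosDef := hS.inv
  have hXt : (S⁻¹)ᵀ = S⁻¹ := by simpa using hX.isHermitian.eq
  have hN : (-(S⁻¹ * M + Mᵀ * S⁻¹)).PosDef := by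
    have h := hL.conjTranspose_mul_mul_same (B := S⁻¹)
      (mulVec_injective_of_isUnit hX.isUnit)
    convert h using 1
    rw [conjTranspose_eq_transpose_of_trivial, hXt]
    simp only [mul_neg, neg_mul, Matrix.mul_add, Matrix.add_mul, ← Matrix.mul_assoc,
      nonsing_inv_mul _ hSinv, Matrix.one_mul]
    simp only [Matrix.mul_assoc, mul_nonsing_inv _ hSinv, Matrix.mul_one]
  set x : k → ℝ := fun i => (v i).re with hx
  set y : k → ℝ := fun i => (v i).im with hy
  have hMx : M *ᵥ x = μ.re • x - μ.im • y := by
    ext i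
    have := congrArg Complex.re (congrFun hMv i)
    simpa [mulVec, dotProduct, hx, hy] using this
  have hMy : M *ᵥ y = μ.re • y + μ.im • x := by
    ext i
    have := congrArg Complex.im (congrFun hMv i)
    simpa [mulVec, dotProduct, hx, hy] using this
  have key : ∀ z : k → ℝ, z ⬝ᵥ (-(S⁻¹ * M + Mᵀ * S⁻¹)) *ᵥ z = -2 * (z ⬝ᵥ S⁻¹ *ᵥ (M *ᵥ z)) := by
    intro z
    have h1 : z ⬝ᵥ (Mᵀ * S⁻¹) *ᵥ z = z ⬝ᵥ (S⁻¹ * M) *ᵥ z := by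
      rw [dotProduct_mulVec, ← mulVec_transpose, dotProduct_comm, transpose_mul, hXt,
        transpose_transpose]
    rw [neg_mulVec, add_mulVec, dotProduct_neg, dotProduct_add, h1, ← mulVec_mulVec]
    ring
  have hsymm : y ⬝ᵥ S⁻¹ *ᵥ x = x ⬝ᵥ S⁻¹ *ᵥ y := by
    rw [dotProduct_mulVec, ← mulVec_transpose, hXt, dotProduct_comm]
  have hsum : x ⬝ᵥ (-(S⁻¹ * M + Mᵀ * S⁻¹)) *ᵥ x + y ⬝ᵥ (-(S⁻¹ * M + Mᵀ * S⁻¹)) *ᵥ y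
      = -2 * μ.re * (x ⬝ᵥ S⁻¹ *ᵥ x + y ⬝ᵥ S⁻¹ *ᵥ y) := by
    rw [key, key, hMx, hMy]
    simp only [mulVec_sub, mulVec_add, mulVec_smul, dotProduct_sub, dotProduct_add,
      dotProduct_smul, smul_eq_mul, hsymm]
    ring
  have hxy : x ≠ 0 ∨ y ≠ 0 := by
    by_contra! h
    exact hv (funext fun i => Complex.ext (congrFun h.1 i) (congrFun h.2 i))
  have pos : ∀ {Q : Matrix k k ℝ}, Q.PosDef → 0 < x ⬝ᵥ Q *ᵥ x + y ⬝ᵥ Q *ᵥ y := by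
    intro Q hQ
    have hx0 := hQ.posSemidef.dotProduct_mulVec_nonneg x
    have hy0 := hQ.posSemidef.dotProduct_mulVec_nonneg y
    rw [star_trivial] at hx0 hy0
    rcases hxy with h | h
    · have := hQ.dotProduct_mulVec_pos h
      rw [star_trivial] at this
      linarith
    · have := hQ.dotProduct_mulVec_pos h
      rw [star_trivial] at this
      linarith
  have h1 := pos hN
  have h2 := pos hX
  rw [hsum] at h1
  by_contra! hμ
  nlinarith [mul_nonneg hμ h2.le]

theorem IsHurwitz.exists_spectrum_one_add_smul_norm_lt_one {M : Matrix k k ℝ} (hM : IsHurwitz M) :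
    ∃ ε : ℝ, 0 < ε ∧ ∀ z ∈ spectrum ℂ ((1 + ε • M).map Complex.ofReal), ‖z‖ < 1 := by
  have hev : ∀ᶠ ε : ℝ in nhdsWithin 0 (Set.Ioi 0),
      ∀ μ ∈ spectrum ℂ (M.map Complex.ofReal), ‖1 + (ε : ℂ) * μ‖ < 1 := by
    rw [Filter.eventually_all_finite (Matrix.finite_spectrum _)]
    intro μ hμ
    have hre := hM μ ((mem_spectrum_iff_exists_mulVec_eq_smul _ _).1 hμ)
    have hlim : Filter.Tendsto (fun ε : ℝ => 2 * μ.re + ε * Complex.normSq μ)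
        (nhdsWithin 0 (Set.Ioi 0)) (nhds (2 * μ.re + 0 * Complex.normSq μ)) :=
      ((by fun_prop : Continuous fun ε : ℝ => 2 * μ.re + ε * Complex.normSq μ).tendsto
        0).mono_left nhdsWithin_le_nhds
    filter_upwards [hlim.eventually_lt_const (u := 0) (by linarith), self_mem_nhdsWithin]
      with ε hε hpos
    have hpos : 0 < ε := hpos
    have hsq : ‖1 + (ε : ℂ) * μ‖ ^ 2 = 1 + ε * (2 * μ.re + ε * Complex.normSq μ) := by
      rw [← Complex.normSq_eq_norm_sq, Complex.normSq_apply, Complex.normSq_apply]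
      simp
      ring
    have : ‖1 + (ε : ℂ) * μ‖ ^ 2 < 1 := by nlinarith
    exact (sq_lt_one_iff₀ (norm_nonneg _)).1 this
  obtain ⟨ε, hε, hpos⟩ := (hev.and self_mem_nhdsWithin).exists
  have hpos : 0 < ε := hpos
  refine ⟨ε, hpos, fun z hz => ?_⟩
  have hεC : (ε : ℂ) ≠ 0 := by exact_mod_cast hpos.ne'
  obtain ⟨v, hv, hzv⟩ := (mem_spectrum_iff_exists_mulVec_eq_smul _ _).1 hz
  have hmap : (1 + ε • M).map Complex.ofReal = 1 + (ε : ℂ) • M.map Complex.ofReal := by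
    ext i j
    by_cases h : i = j <;> simp [h]
  have hmem : (z - 1) / ε ∈ spectrum ℂ (M.map Complex.ofReal) := by
    refine (mem_spectrum_iff_exists_mulVec_eq_smul _ _).2 ⟨v, hv, ?_⟩
    rw [hmap, add_mulVec, one_mulVec, smul_mulVec] at hzv
    have : (ε : ℂ) • (M.map Complex.ofReal *ᵥ v) = (z - 1) • v := by
      rw [sub_smul, one_smul, ← hzv, add_sub_cancel_left]
    rw [div_eq_inv_mul, mul_smul, ← this, smul_smul, inv_mul_cancel₀ hεC, one_smul]
  have := hε _ hmem
  rwa [mul_div_cancel₀ _ hεC, add_sub_cancel] at this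

open scoped Matrix.Norms.L2Operator in
theorem exists_posDef_one_sub_pow_mul_transpose [Nonempty k] {N : Matrix k k ℝ}
    (hN : ∀ z ∈ spectrum ℂ (N.map Complex.ofReal), ‖z‖ < 1) :
    ∃ m : ℕ, 0 < m ∧ (1 - N ^ m * (N ^ m)ᵀ).PosDef := by
  have hρ : spectralRadius ℂ (N.map Complex.ofReal) < 1 := by
    simpa using spectrum.spectralRadius_lt_of_forall_lt (N.map Complex.ofReal) (r := 1)
      fun z hz => by simpa [← NNReal.coe_lt_coe] using hN z hz
  obtain ⟨m, hm, hpos⟩ :=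
    (((spectrum.pow_nnnorm_pow_one_div_tendsto_nhds_spectralRadius _).eventually_lt_const
      hρ).and (Filter.eventually_gt_atTop 0)).exists
  refine ⟨m, hpos, ?_⟩
  have hnorm : ‖(N.map Complex.ofReal) ^ m‖ < 1 := by
    by_contra! h
    refine hm.not_ge (ENNReal.one_le_rpow ?_ (by positivity))
    exact_mod_cast h
  have hmap : ((N ^ m)ᵀ).map Complex.ofReal = ((N.map Complex.ofReal) ^ m)ᴴ := by
    have : (N ^ m).map Complex.ofReal = (N.map Complex.ofReal) ^ m :=
      map_pow Complex.ofRealHom.mapMatrix N m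
    rw [← this]
    ext i j
    simp only [map_apply, transpose_apply, conjTranspose_apply, Complex.star_def,
      Complex.conj_ofReal]
  refine PosDef.of_dotProduct_mulVec_pos ?_ fun x hx => ?_
  · simp [IsHermitian]
  set y := (N ^ m)ᵀ *ᵥ x with hy
  have hq : star x ⬝ᵥ (1 - N ^ m * (N ^ m)ᵀ) *ᵥ x = x ⬝ᵥ x - y ⬝ᵥ y := by
    rw [star_trivial, sub_mulVec, one_mulVec, dotProduct_sub, ← mulVec_mulVec, dotProduct_mulVec,
      ← mulVec_transpose]
  have hb := l2_opNorm_mulVec ((N.map Complex.ofReal) ^ m)ᴴ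
    (WithLp.toLp 2 fun i => (x i : ℂ))
  have hyC : ((N.map Complex.ofReal) ^ m)ᴴ *ᵥ (fun i => (x i : ℂ)) = fun i => (y i : ℂ) := by
    rw [← hmap]
    ext i
    simp [hy, mulVec, dotProduct]
  have hnsq : ∀ w : k → ℝ, ‖(WithLp.toLp 2 fun i => (w i : ℂ) : EuclideanSpace ℂ k)‖ ^ 2
      = w ⬝ᵥ w := by
    intro w
    simp [EuclideanSpace.norm_sq_eq, dotProduct, ← sq]
  have hxpos : 0 < x ⬝ᵥ x := by
    have := dotProduct_star_self_pos_iff.2 hx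
    simpa using this
  rw [l2_opNorm_conjTranspose] at hb
  simp only [hyC] at hb
  change ‖(WithLp.toLp 2 fun i => (y i : ℂ) : EuclideanSpace ℂ k)‖ ≤ _ at hb
  have hxn : 0 < ‖(WithLp.toLp 2 fun i => (x i : ℂ) : EuclideanSpace ℂ k)‖ := by
    by_contra! h
    rw [← hnsq, le_antisymm h (norm_nonneg _)] at hxpos
    simp at hxpos
  have hlt := hb.trans_lt (mul_lt_of_lt_one_left hxn hnorm)
  rw [hq, ← hnsq, ← hnsq, sub_pos]
  gcongr

theorem sub_mul_sum_pow_mul_transpose_mul {R : Type*} [CommRing R] (N : Matrix k k R) (m : ℕ) :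
    (∑ j ∈ Finset.range m, N ^ j * (N ^ j)ᵀ)
      - N * (∑ j ∈ Finset.range m, N ^ j * (N ^ j)ᵀ) * Nᵀ = 1 - N ^ m * (N ^ m)ᵀ := by
  have h : N * (∑ j ∈ Finset.range m, N ^ j * (N ^ j)ᵀ) * Nᵀ
      = ∑ j ∈ Finset.range m, N ^ (j + 1) * (N ^ (j + 1))ᵀ := by
    rw [Finset.mul_sum, Finset.sum_mul]
    refine Finset.sum_congr rfl fun j _ => ?_
    rw [pow_succ', transpose_mul]
    simp only [Matrix.mul_assoc]
  rw [h, ← Finset.sum_sub_distrib, Finset.sum_range_sub' fun j => N ^ j * (N ^ j)ᵀ]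
  simp

theorem IsHurwitz.exists_lyapunov {M : Matrix k k ℝ} (hM : IsHurwitz M) :
    ∃ S : Matrix k k ℝ, S.PosDef ∧ (-(M * S + S * Mᵀ)).PosDef := by
  cases isEmpty_or_nonempty k
  · refine ⟨1, PosDef.one, ?_⟩
    rw [Subsingleton.elim (-(M * 1 + 1 * Mᵀ)) 1]
    exact PosDef.one
  obtain ⟨ε, hε, hspec⟩ := hM.exists_spectrum_one_add_smul_norm_lt_one
  obtain ⟨m, hm, hD⟩ := exists_posDef_one_sub_pow_mul_transpose hspec
  set N := 1 + ε • M with hN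
  set P := ∑ j ∈ Finset.range m, N ^ j * (N ^ j)ᵀ with hP
  have hpsd : ∀ j, (N ^ j * (N ^ j)ᵀ).PosSemidef := fun j => by
    simpa only [conjTranspose_eq_transpose_of_trivial] using
      posSemidef_self_mul_conjTranspose (N ^ j)
  have hPpos : P.PosDef := by
    obtain ⟨l, rfl⟩ := Nat.exists_eq_succ_of_ne_zero hm.ne'
    rw [hP, Finset.sum_range_succ']
    refine PosDef.posSemidef_add (posSemidef_sum _ fun j _ => hpsd _) ?_
    simpa using PosDef.one
  refine ⟨P, hPpos, ?_⟩
  have hMP : (M * P * Mᵀ).PosSemidef := by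
    simpa only [conjTranspose_eq_transpose_of_trivial] using
      hPpos.posSemidef.mul_mul_conjTranspose_same M
  have hid : -(M * P + P * Mᵀ) = ε⁻¹ • (1 - N ^ m * (N ^ m)ᵀ) + ε • (M * P * Mᵀ) := by
    rw [← sub_mul_sum_pow_mul_transpose_mul, ← hP]
    have : N * P * Nᵀ = P + ε • (M * P + P * Mᵀ) + (ε * ε) • (M * P * Mᵀ) := by
      rw [hN]
      simp only [transpose_add, transpose_one, transpose_smul, Matrix.add_mul, Matrix.mul_add,
        Matrix.one_mul, Matrix.mul_one, smul_mul_assoc, mul_smul_comm, smul_add, smul_smul]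
      abel
    rw [this]
    simp only [smul_sub, smul_add, smul_smul, neg_add, ← mul_assoc, inv_mul_cancel₀ hε.ne',
      one_mul, one_smul]
    abel
  rw [hid]
  exact (hD.smul (inv_pos.2 hε)).add_posSemidef (hMP.smul hε.le)

end Hurwitz

section Coordinates

variable {m q n : Type*} [Fintype m] [Fintype q] [Fintype n]

theorem posDef_mul_mul_transpose_add {P : Matrix n m ℝ} {R : Matrix n q ℝ} {S : Matrix m m ℝ}
    (hS : S.PosDef) (hinj : ∀ x, Pᵀ *ᵥ x = 0 → Rᵀ *ᵥ x = 0 → x = 0) :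
    (P * S * Pᵀ + R * Rᵀ).PosDef := by
  have hSt : Sᵀ = S := by simpa using hS.isHermitian.eq
  refine PosDef.of_dotProduct_mulVec_pos ?_ fun x hx => ?_
  · simp [IsHermitian, hSt, Matrix.mul_assoc]
  have hq : star x ⬝ᵥ (P * S * Pᵀ + R * Rᵀ) *ᵥ x
      = (Pᵀ *ᵥ x) ⬝ᵥ S *ᵥ (Pᵀ *ᵥ x) + (Rᵀ *ᵥ x) ⬝ᵥ (Rᵀ *ᵥ x) := by
    rw [star_trivial, add_mulVec, dotProduct_add, Matrix.mul_assoc, ← mulVec_mulVec,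
      ← mulVec_mulVec, ← mulVec_mulVec, dotProduct_mulVec x P, dotProduct_mulVec x R,
      ← mulVec_transpose, ← mulVec_transpose]
  rw [hq]
  have h1 := hS.posSemidef.dotProduct_mulVec_nonneg (Pᵀ *ᵥ x)
  have h2 := dotProduct_star_self_nonneg (Rᵀ *ᵥ x)
  rw [star_trivial] at h1 h2
  by_cases hP : Pᵀ *ᵥ x = 0
  · have := dotProduct_star_self_pos_iff.2 (mt (hinj x hP) hx)
    rw [star_trivial] at this
    linarith
  · have := hS.dotProduct_mulVec_pos hP
    rw [star_trivial] at this
    linarith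

/-- A matrix is determined by its products with a pair `Cz`, `C` that has a joint left inverse. -/
theorem eq_of_mul_eq_of_mul_eq [DecidableEq n] {l : Type*} {Cz : Matrix m n ℝ} {C : Matrix q n ℝ}
    {P : Matrix n m ℝ} {Q : Matrix n q ℝ} (hsum : P * Cz + Q * C = 1) {A W : Matrix n l ℝ}
    (h1 : Cz * A = Cz * W) (h2 : C * A = C * W) : A = W := by
  rw [← Matrix.one_mul A, ← Matrix.one_mul W, ← hsum]
  simp only [Matrix.add_mul, Matrix.mul_assoc, h1, h2]

theorem isHurwitz_zeroDynamics_of_lyapunov [DecidableEq m] [DecidableEq n]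
    {A : Matrix n n ℝ} {B : Matrix n q ℝ}
    {Cz : Matrix m n ℝ} {C : Matrix q n ℝ} {P : Matrix n m ℝ} {Q : Matrix n q ℝ}
    (hsum : P * Cz + Q * C = 1) (hCzP : Cz * P = 1) (hCzB : Cz * B = 0)
    {Kv : Matrix q q ℝ} {Y : Matrix n n ℝ} (hY : Y.PosDef)
    (hL : (-(A * Y + Y * Aᵀ)).PosDef) (hBK : B * Kv + A * Y * Cᵀ = 0) :
    IsHurwitz (Cz * A * P) := by
  have hYu : IsUnit Y.det := (isUnit_iff_isUnit_det _).1 hY.isUnit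
  have hYt : Yᵀ = Y := by simpa using hY.isHermitian.eq
  have hPinj : Function.Injective P.mulVec := by
    intro x y hxy
    simpa [mulVec_mulVec, hCzP] using congrArg (Cz *ᵥ ·) hxy
  have hCzinj : Function.Injective Czᵀ.mulVec := by
    intro x y hxy
    have h := congrArg (Pᵀ *ᵥ ·) hxy
    simpa [mulVec_mulVec, ← transpose_mul, hCzP] using h
  have hX : (Pᵀ * Y⁻¹ * P).PosDef := by
    simpa only [conjTranspose_eq_transpose_of_trivial] using
      hY.inv.conjTranspose_mul_mul_same hPinj
  have hXu : IsUnit (Pᵀ * Y⁻¹ * P).det := (isUnit_iff_isUnit_det _).1 hX.isUnit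
  set S := (Pᵀ * Y⁻¹ * P)⁻¹ with hSdef
  have hS : S.PosDef := hX.inv
  have hSt : Sᵀ = S := by simpa using hS.isHermitian.eq
  have hCAYC : Cz * A * Y * Cᵀ = 0 := by
    have h := congrArg (Cz * ·) hBK
    simpa [Matrix.mul_add, ← Matrix.mul_assoc, hCzB] using h
  set w := Y⁻¹ * P * S with hw
  have hPw : Pᵀ * w = 1 := by
    rw [hw, ← Matrix.mul_assoc, ← Matrix.mul_assoc, hSdef, mul_nonsing_inv _ hXu]
  have hwexp : w = Czᵀ + Cᵀ * (Qᵀ * w) := by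
    calc w = (P * Cz + Q * C)ᵀ * w := by rw [hsum, transpose_one, Matrix.one_mul]
      _ = Czᵀ * (Pᵀ * w) + Cᵀ * (Qᵀ * w) := by
        simp only [transpose_add, transpose_mul, Matrix.add_mul, Matrix.mul_assoc]
      _ = _ := by rw [hPw, Matrix.mul_one]
  have hAS : Cz * A * P * S = Cz * A * Y * Czᵀ := by
    calc Cz * A * P * S = Cz * A * Y * w := by
          rw [hw, Matrix.mul_assoc (Cz * A) Y, ← Matrix.mul_assoc Y, ← Matrix.mul_assoc Y,
            mul_nonsing_inv _ hYu, Matrix.one_mul, ← Matrix.mul_assoc]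
      _ = Cz * A * Y * Czᵀ := by
          rw [hwexp, Matrix.mul_add, ← Matrix.mul_assoc _ Cᵀ, hCAYC, Matrix.zero_mul, add_zero]
  refine isHurwitz_of_lyapunov hS ?_
  have hSA : S * (Cz * A * P)ᵀ = Cz * Y * Aᵀ * Czᵀ := by
    have := congrArg transpose hAS
    simpa [transpose_mul, hSt, hYt, Matrix.mul_assoc] using this
  have h := hL.conjTranspose_mul_mul_same hCzinj
  rw [hAS, hSA]
  convert h using 1
  simp only [conjTranspose_eq_transpose_of_trivial, transpose_transpose, Matrix.mul_neg,
    Matrix.neg_mul, Matrix.mul_add, Matrix.add_mul, Matrix.mul_assoc]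

theorem IsHurwitz.exists_feedback_of_zeroDynamics [DecidableEq m] [DecidableEq q]
    [DecidableEq n]
    {A : Matrix n n ℝ} {B : Matrix n q ℝ}
    {Cz : Matrix m n ℝ} {C : Matrix q n ℝ} {P : Matrix n m ℝ} {Q : Matrix n q ℝ}
    (hsum : P * Cz + Q * C = 1) (hCzP : Cz * P = 1) (hCzQ : Cz * Q = 0) (hCP : C * P = 0)
    (hCQ : C * Q = 1) (hCzB : Cz * B = 0) (hCB : IsUnit (C * B).det)
    (hH : IsHurwitz (Cz * A * P)) :
    ∃ (Kx : Matrix q n ℝ) (Kv : Matrix q q ℝ), IsUnit Kv.det ∧ IsHurwitz (A + B * Kx) ∧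
      ∃ Y : Matrix n n ℝ, Y.PosDef ∧ (-((A + B * Kx) * Y + Y * (A + B * Kx)ᵀ)).PosDef ∧
        B * Kv + (A + B * Kx) * Y * Cᵀ = 0 := by
  obtain ⟨S, hS, hL⟩ := hH.exists_lyapunov
  have hSt : Sᵀ = S := by simpa using hS.isHermitian.eq
  have hAu := hH.isUnit_det
  set A11 := Cz * A * P with hA11
  set R := Q - P * (A11⁻¹ * (Cz * A * Q)) with hR
  set Y := P * S * Pᵀ + R * Rᵀ with hYdef
  have hinj : ∀ x, Pᵀ *ᵥ x = 0 → Qᵀ *ᵥ x = 0 → x = 0 := by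
    intro x h1 h2
    calc x = (P * Cz + Q * C)ᵀ *ᵥ x := by rw [hsum, transpose_one, one_mulVec]
      _ = 0 := by
        simp only [transpose_add, transpose_mul, add_mulVec, ← mulVec_mulVec, h1, h2, mulVec_zero,
          add_zero]
  have hY : Y.PosDef := by
    refine posDef_mul_mul_transpose_add hS fun x h1 h2 => hinj x h1 ?_
    rwa [hR, transpose_sub, transpose_mul, sub_mulVec, ← mulVec_mulVec, h1, mulVec_zero,
      sub_zero] at h2
  have hYt : Yᵀ = Y := by simpa using hY.isHermitian.eq
  have hYu : IsUnit Y.det := (isUnit_iff_isUnit_det _).1 hY.isUnit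
  set W := P * A11 * S * Pᵀ - Q * Qᵀ with hW
  have hCzAR : Cz * A * R = 0 := by
    rw [hR, Matrix.mul_sub, ← Matrix.mul_assoc, ← hA11, ← Matrix.mul_assoc A11,
      mul_nonsing_inv _ hAu, Matrix.one_mul, sub_self]
  have hCzW : Cz * W = A11 * S * Pᵀ := by
    simp only [hW, Matrix.mul_sub, ← Matrix.mul_assoc, hCzP, hCzQ, Matrix.one_mul,
      Matrix.zero_mul, sub_zero]
  have hCzAY : Cz * A * Y = Cz * W := by
    rw [hCzW, hYdef, Matrix.mul_add, ← Matrix.mul_assoc _ R, hCzAR, Matrix.zero_mul, add_zero,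
      ← Matrix.mul_assoc, ← Matrix.mul_assoc]
  set Kx := (C * B)⁻¹ * (C * W * Y⁻¹ - C * A) with hKx
  have hF : A + B * Kx = W * Y⁻¹ := by
    refine eq_of_mul_eq_of_mul_eq hsum ?_ ?_
    · rw [Matrix.mul_add, ← Matrix.mul_assoc Cz B, hCzB, Matrix.zero_mul, add_zero,
        ← Matrix.mul_assoc, ← hCzAY, Matrix.mul_assoc _ Y, mul_nonsing_inv _ hYu, Matrix.mul_one]
    · rw [Matrix.mul_add, hKx, ← Matrix.mul_assoc C B, ← Matrix.mul_assoc (C * B),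
        mul_nonsing_inv _ hCB, Matrix.one_mul, add_sub_cancel, Matrix.mul_assoc]
  have hFY : (A + B * Kx) * Y = W := by
    rw [hF, Matrix.mul_assoc, nonsing_inv_mul _ hYu, Matrix.mul_one]
  have hYF : Y * (A + B * Kx)ᵀ = Wᵀ := by
    rw [← hFY, transpose_mul, hYt]
  have hLW : (-(W + Wᵀ)).PosDef := by
    have h := posDef_mul_mul_transpose_add (P := P) (R := Q) hL hinj
    have hQ : (Q * Qᵀ).PosSemidef := by
      simpa only [conjTranspose_eq_transpose_of_trivial] using posSemidef_self_mul_conjTranspose Q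
    convert h.add_posSemidef hQ using 1
    simp only [hW, transpose_sub, transpose_mul, transpose_transpose, hSt, Matrix.mul_neg,
      Matrix.neg_mul, Matrix.mul_add, Matrix.add_mul, Matrix.mul_assoc]
    abel
  refine ⟨Kx, (C * B)⁻¹, isUnit_nonsing_inv_det _ hCB, ?_, Y, hY, ?_, ?_⟩
  · exact isHurwitz_of_lyapunov hY (by rwa [hFY, hYF])
  · rwa [hFY, hYF]
  · have hWC : W * Cᵀ = -Q := by
      rw [hW, Matrix.sub_mul, Matrix.mul_assoc _ Pᵀ, Matrix.mul_assoc Q, ← transpose_mul,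
        ← transpose_mul, hCP, hCQ, transpose_zero, transpose_one, Matrix.mul_zero, Matrix.mul_one,
        zero_sub]
    rw [hFY, hWC, add_neg_eq_zero]
    refine eq_of_mul_eq_of_mul_eq hsum ?_ ?_
    · rw [← Matrix.mul_assoc, hCzB, Matrix.zero_mul, hCzQ]
    · rw [← Matrix.mul_assoc, mul_nonsing_inv _ hCB, hCQ]

end Coordinates

/-- Main SSNI theorem, relative degree one case: a controllable system `(𝒜, ℬ, 𝒞)` of
relative degree one is state feedback equivalent (`u = K_x x + K_v v`) to an SSNI system
iff it is minimum phase (the zero dynamics matrix `A11` is Hurwitz). -/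
theorem main_SSNI_state_feedback_equivalence_relative_degree_one
    (n p : ℕ) (hpn : p ≤ n)
    (𝒜 : Matrix (Fin n) (Fin n) ℝ) (ℬ : Matrix (Fin n) (Fin p) ℝ)
    (𝒞 : Matrix (Fin p) (Fin n) ℝ) (hCB : (𝒞 * ℬ).det ≠ 0)
    (hctrb : IsControllablePair 𝒜 ℬ)
    (𝒞z : Matrix (Fin (n - p)) (Fin n) ℝ) (h𝒞z : 𝒞z * ℬ = 0)
    (T : Matrix (Fin n) (Fin n) ℝ)
    (hTdef : T = (Matrix.fromRows 𝒞z 𝒞).submatrix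
      (finSumFinEquiv.trans (finCongr (Nat.sub_add_cancel hpn))).symm id)
    (hT : IsUnit T)
    (A11 : Matrix (Fin (n - p)) (Fin (n - p)) ℝ)
    (hA11def : A11 = ((T * 𝒜 * T⁻¹).submatrix
      (⇑(finSumFinEquiv.trans (finCongr (Nat.sub_add_cancel hpn))))
      (⇑(finSumFinEquiv.trans (finCongr (Nat.sub_add_cancel hpn))))).toBlocks₁₁) :
    IsHurwitz A11 ↔
    (∃ (Kx : Matrix (Fin p) (Fin n) ℝ) (Kv : Matrix (Fin p) (Fin p) ℝ),
      IsUnit Kv.det ∧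
      IsHurwitz (𝒜 + ℬ * Kx) ∧
      ∃ Y : Matrix (Fin n) (Fin n) ℝ, Y.PosDef ∧
        (-((𝒜 + ℬ * Kx) * Y + Y * (𝒜 + ℬ * Kx)ᵀ)).PosDef ∧
        ℬ * Kv + (𝒜 + ℬ * Kx) * Y * 𝒞ᵀ = 0) := by
  set e := finSumFinEquiv.trans (finCongr (Nat.sub_add_cancel hpn)) with he
  have hTu : IsUnit T.det := (isUnit_iff_isUnit_det _).1 hT
  set P : Matrix (Fin n) (Fin (n - p)) ℝ := T⁻¹.submatrix id (e ∘ Sum.inl) with hP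
  set Q : Matrix (Fin n) (Fin p) ℝ := T⁻¹.submatrix id (e ∘ Sum.inr) with hQ
  have hTe : T.submatrix e id = fromRows 𝒞z 𝒞 := by
    rw [hTdef, submatrix_submatrix]
    simp
  have hTinv : T⁻¹.submatrix id e = fromCols P Q := by
    ext i (j | j) <;> rfl
  have hright : fromRows 𝒞z 𝒞 * fromCols P Q = 1 := by
    rw [← hTe, ← hTinv, ← submatrix_mul _ _ _ _ _ Function.bijective_id, mul_nonsing_inv _ hTu,
      submatrix_one_equiv]
  have hsum : P * 𝒞z + Q * 𝒞 = 1 := by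
    rw [← fromCols_mul_fromRows, ← hTe, ← hTinv, submatrix_mul_equiv, nonsing_inv_mul _ hTu,
      submatrix_id_id]
  rw [fromRows_mul_fromCols, ← fromBlocks_one, fromBlocks_inj] at hright
  obtain ⟨hCzP, hCzQ, hCP, hCQ⟩ := hright
  have hA : A11 = 𝒞z * 𝒜 * P := by
    have hCz : 𝒞z = T.submatrix (e ∘ Sum.inl) id := (congrArg toRows₁ hTe).symm
    rw [hA11def, hCz]
    rfl
  rw [hA]
  constructor
  · exact IsHurwitz.exists_feedback_of_zeroDynamics hsum hCzP hCzQ hCP hCQ h𝒞z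
      (isUnit_iff_ne_zero.2 hCB)
  · rintro ⟨Kx, Kv, -, -, Y, hY, hL, hBK⟩
    have h := isHurwitz_zeroDynamics_of_lyapunov hsum hCzP h𝒞z hY hL hBK
    rwa [Matrix.mul_add, ← Matrix.mul_assoc 𝒞z ℬ, h𝒞z, Matrix.zero_mul, add_zero] at h
end
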